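/- q-analogue of Konvalinka–Lauve's Lemma 5: for all partitions λ, ν, Σ_μ (−t)^{|λ|−|μ|} vs_{λ/μ}(q,t) Q_{μ/ν}((1−qt)/(1−t)) = hs_{λ/ν}(q,t), where the sum is over all partitions μ with ν ⊆ μ ⊆ λ. -/

import Mathlib

/-!
Common framework: integer partitions, Gaussian binomials, Hall--Littlewood
Pieri coefficients, the ring of symmetric functions realized as polynomials
in the power sums, the Macdonald `(q,t)`-inner product, a characterisation
of the Macdonald polynomials `P_λ(X;q,t)`, skew Macdonald polynomials,
plethystic evaluations and the various Pieri coefficients of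
Konvalinka--Lauve and Warnaar.
-/

open scoped BigOperators

noncomputable section

namespace SkewPieriFormalization

/-- An integer partition, encoded as a finitely supported weakly decreasing
sequence of natural numbers; `part j` is the part `λ_{j+1}` (0-indexed). -/
structure Partition where
  part : ℕ →₀ ℕ
  antitone' : ∀ ⦃i j : ℕ⦄, i ≤ j → part j ≤ part i

namespace Partition

/-- Containment of Young diagrams: `μ ≤ λ` iff `μ_i ≤ λ_i` for all `i`. -/
instance : LE Partition := ⟨fun mu lam => ∀ j : ℕ, mu.part j ≤ lam.part j⟩

/-- `|λ|`, the size (sum of the parts). -/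
def size (lam : Partition) : ℕ := lam.part.sum fun _ k => k

/-- `l(λ)`, the number of (nonzero) parts. -/
def length (lam : Partition) : ℕ := lam.part.support.card

/-- `n(λ) = ∑_{i ≥ 1} (i-1) λ_i`. -/
def nstat (lam : Partition) : ℕ := lam.part.sum fun j k => j * k

/-- the `i`-th part `λ_i` (1-indexed). -/
def row (lam : Partition) (i : ℕ) : ℕ := lam.part (i - 1)

/-- the part `λ'_i = #{j : λ_j ≥ i}` of the conjugate partition (for `i ≥ 1`). -/
def conj (lam : Partition) (i : ℕ) : ℕ :=
  (lam.part.support.filter fun j => i ≤ lam.part j).card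

/-- the multiplicity `m_r(λ)` of `r` as a part of `λ`. -/
def mult (lam : Partition) (r : ℕ) : ℕ :=
  (lam.part.support.filter fun j => lam.part j = r).card

/-- `z_λ = ∏_{r ≥ 1} r^{m_r} m_r!`. -/
def zee (lam : Partition) : ℕ :=
  ∏ r ∈ Finset.Icc 1 (lam.part 0), r ^ lam.mult r * Nat.factorial (lam.mult r)

/-- the partial sum `λ_1 + ⋯ + λ_k`. -/
def psum (lam : Partition) (k : ℕ) : ℕ := ∑ j ∈ Finset.range k, lam.part j

/-- dominance order: `λ ⊵ μ` (for `|λ| = |μ|`). -/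
def Dominates (lam mu : Partition) : Prop :=
  mu.size = lam.size ∧ ∀ k : ℕ, mu.psum k ≤ lam.psum k

/-- the one-row partition `(r)`. -/
def single (r : ℕ) : Partition where
  part := Finsupp.single 0 r
  antitone' := by
    intro i j hij
    by_cases hj : j = 0
    · have : i = 0 := by omega
      simp [hj, this]
    · simp only [Finsupp.single_apply]
      split <;> split <;> omega

/-- the one-column partition `(1^m)`. -/
def column (m : ℕ) : Partition where
  part := Finsupp.onFinset (Finset.range m) (fun j => if j < m then 1 else 0)
    (fun j h => by
      simp only [Finset.mem_range]
      by_contra hc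
      simp [hc] at h)
  antitone' := by
    intro i j hij
    simp only [Finsupp.onFinset_apply]
    split <;> split <;> omega

end Partition

variable {F : Type*} [Field F]

/-- the `t`-integer `[n]_t = 1 + t + ⋯ + t^{n-1}`. -/
def qint (t : F) (n : ℕ) : F := ∑ j ∈ Finset.range n, t ^ j

/-- the `t`-factorial. -/
def qfac (t : F) (n : ℕ) : F := ∏ j ∈ Finset.range n, qint t (j + 1)

/-- the Gaussian binomial coefficient `[n choose k]_t`; it vanishes
unless `0 ≤ k ≤ n`. -/
def qbinom (t : F) (n k : ℤ) : F :=
  if 0 ≤ k ∧ k ≤ n then qfac t n.toNat / (qfac t k.toNat * qfac t (n - k).toNat) else 0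

/-- the Hall--Littlewood Pieri coefficient
`ψ'_{λ/μ}(t) = ∏_{i ≥ 1} [λ'_i - λ'_{i+1} choose λ'_i - μ'_i]_t`;
it vanishes unless `μ ⊆ λ` with `λ - μ` a vertical strip. -/
def vsHL (t : F) (lam mu : Partition) : F :=
  ∏ i ∈ Finset.Icc 1 (lam.part 0 + mu.part 0),
    qbinom t ((lam.conj i : ℤ) - lam.conj (i + 1)) ((lam.conj i : ℤ) - mu.conj i)

open Classical in
/-- the Hall--Littlewood Pieri coefficient `φ_{λ/μ}(t)`, equal to
`∏ (1 - t^{λ'_i - λ'_{i+1}})` over those `i ≥ 1` with `λ'_i = μ'_i + 1` and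
`λ'_{i+1} = μ'_{i+1}`, when `μ ⊆ λ` with `λ - μ` a horizontal strip, and
vanishing otherwise. -/
def hsHL (t : F) (lam mu : Partition) : F :=
  if ∀ i : ℕ, mu.conj i ≤ lam.conj i ∧ lam.conj i ≤ mu.conj i + 1 then
    ∏ i ∈ Finset.Icc 1 (lam.part 0 + mu.part 0),
      if lam.conj i = mu.conj i + 1 ∧ lam.conj (i + 1) = mu.conj (i + 1) then
        1 - t ^ (lam.conj i - lam.conj (i + 1))
      else 1
  else 0

/-- `n(λ/μ) = ∑_{i ≥ 1} C(λ'_i - μ'_i, 2)`. -/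
def nskew (lam mu : Partition) : ℕ :=
  ∑ i ∈ Finset.Icc 1 (lam.part 0 + mu.part 0), Nat.choose (lam.conj i - mu.conj i) 2

/-- the Konvalinka--Lauve coefficient
`sk_{λ/μ}(t) = t^{n(λ/μ)} ∏_{i ≥ 1} [λ'_i - μ'_{i+1} choose λ'_i - μ'_i]_t`;
it vanishes unless `μ ⊆ λ`. -/
def skHL (t : F) (lam mu : Partition) : F :=
  t ^ nskew lam mu *
    ∏ i ∈ Finset.Icc 1 (lam.part 0 + mu.part 0),
      qbinom t ((lam.conj i : ℤ) - mu.conj (i + 1)) ((lam.conj i : ℤ) - mu.conj i)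

/-- The ring of symmetric functions over `F`, realized as the polynomial ring
in the power sums: the variable `n` is the power sum `p_{n+1}`. -/
abbrev Sym (F : Type*) [Field F] := MvPolynomial ℕ F

/-- the power sum product `p_λ = p_{λ_1} p_{λ_2} ⋯`. -/
def pprod (lam : Partition) : Sym F :=
  ∏ j ∈ lam.part.support, MvPolynomial.X (lam.part j - 1)

/-- Macdonald's `(q,t)`-deformation of the Hall inner product, for which the
power sums are orthogonal with `⟨p_λ, p_λ⟩ = z_λ ∏_i (1-q^{λ_i})/(1-t^{λ_i})`. -/
def innerQT (q t : F) (f g : Sym F) : F :=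
  ∑ d ∈ f.support,
    f.coeff d * g.coeff d *
      d.prod fun n m =>
        (((n : F) + 1) ^ m * (Nat.factorial m : F)) *
          ((1 - q ^ (n + 1)) / (1 - t ^ (n + 1))) ^ m

/-- the complete homogeneous symmetric function `h_r = ∑_{|κ| = r} z_κ⁻¹ p_κ`. -/
def hsym (F : Type*) [Field F] (r : ℕ) : Sym F :=
  ∑ᶠ (k : Partition) (_ : k.size = r), ((k.zee : F))⁻¹ • (pprod k : Sym F)

/-- the elementary symmetric function `e_r = ∑_{|κ| = r} (-1)^{r - l(κ)} z_κ⁻¹ p_κ`. -/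
def esym (F : Type*) [Field F] (r : ℕ) : Sym F :=
  ∑ᶠ (k : Partition) (_ : k.size = r),
    ((-1 : F) ^ (r - k.length) * (k.zee : F)⁻¹) • (pprod k : Sym F)

/-- `h_μ = h_{μ_1} h_{μ_2} ⋯`. -/
def hprod (F : Type*) [Field F] (mu : Partition) : Sym F :=
  ∏ j ∈ mu.part.support, hsym F (mu.part j)

/-- Characterisation of the (monic) Macdonald polynomial family
`λ ↦ P_λ(X;q,t)`: the `P_λ` are pairwise orthogonal for the `(q,t)`-inner
product, and `P_λ = m_λ + ∑_{μ ⊲ λ} u_{λμ} m_μ` is unitriangular with respect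
to dominance order in the monomial basis.  Since `{h_μ}` is the dual basis of
`{m_μ}` for the classical Hall pairing (the case `q = t`), unitriangularity is
expressed by the last two conditions.  For `q = 0` this characterises the
Hall--Littlewood polynomials `P_λ(X;t)`. -/
def IsMacdonald (q t : F) (P : Partition → Sym F) : Prop :=
  (∀ lam mu, lam ≠ mu → innerQT q t (P lam) (P mu) = 0) ∧
  (∀ lam, innerQT t t (P lam) (hprod F lam) = 1) ∧
  (∀ lam mu, ¬ Partition.Dominates lam mu → innerQT t t (P lam) (hprod F mu) = 0)

/-- `b_λ = ⟨P_λ, P_λ⟩⁻¹`. -/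
def bnorm (q t : F) (P : Partition → Sym F) (lam : Partition) : F :=
  (innerQT q t (P lam) (P lam))⁻¹

/-- `Q_λ = b_λ P_λ`. -/
def macQ (q t : F) (P : Partition → Sym F) (lam : Partition) : Sym F :=
  bnorm q t P lam • P lam

/-- the skew Macdonald polynomial `Q_{λ/μ}`, defined by
`⟨Q_{λ/μ}, P_ν⟩ = ⟨Q_λ, P_μ P_ν⟩`. -/
def skewQ (q t : F) (P : Partition → Sym F) (lam mu : Partition) : Sym F :=
  ∑ᶠ nu : Partition, innerQT q t (macQ q t P lam) (P mu * P nu) • macQ q t P nu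

/-- the skew Macdonald polynomial `P_{λ/μ}`, defined by
`⟨P_{λ/μ}, Q_ν⟩ = ⟨P_λ, Q_μ Q_ν⟩`. -/
def skewP (q t : F) (P : Partition → Sym F) (lam mu : Partition) : Sym F :=
  ∑ᶠ nu : Partition, innerQT q t (P lam) (macQ q t P mu * macQ q t P nu) • P nu

/-- the Littlewood--Richardson coefficient `f_{μν}^λ(q,t) = ⟨Q_λ, P_μ P_ν⟩`,
so that `P_μ P_ν = ∑_λ f_{μν}^λ P_λ`. -/
def lr (q t : F) (P : Partition → Sym F) (mu nu lam : Partition) : F :=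
  innerQT q t (macQ q t P lam) (P mu * P nu)

/-- the plethystic evaluation `f ↦ f((a-b)/(1-t))`, determined on power sums
by `p_r ↦ (a^r - b^r)/(1 - t^r)`. -/
def plethAB (t a b : F) (f : Sym F) : F :=
  MvPolynomial.eval (fun n => (a ^ (n + 1) - b ^ (n + 1)) / (1 - t ^ (n + 1))) f

/-- `vs_{λ/μ}(q,t) = ψ'_{λ/μ}(q,t) = (-1)^{|λ|-|μ|} Q_{λ/μ}((q-1)/(1-t))`. -/
def vsM (q t : F) (P : Partition → Sym F) (lam mu : Partition) : F :=
  (-1 : F) ^ ((lam.size : ℤ) - (mu.size : ℤ)) * plethAB t q 1 (skewQ q t P lam mu)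

/-- `sk_{λ/μ}(q,t) = Q_{λ/μ}((1-q)/(1-t))`. -/
def skM (q t : F) (P : Partition → Sym F) (lam mu : Partition) : F :=
  plethAB t 1 q (skewQ q t P lam mu)

/-- `ŝk_{λ/μ}(q,t) = Q_{λ/μ}((1-q/t)/(1-t))`. -/
def skHatM (q t : F) (P : Partition → Sym F) (lam mu : Partition) : F :=
  plethAB t 1 (q / t) (skewQ q t P lam mu)

/-- `hs_{λ/μ}(q,t) = φ_{λ/μ}(q,t) = Q_{λ/μ}(1)`, the plethystic evaluation
`p_r ↦ 1`. -/
def hsM (q t : F) (P : Partition → Sym F) (lam mu : Partition) : F :=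
  MvPolynomial.eval (fun _ => (1 : F)) (skewQ q t P lam mu)

/-- `ks_{λ/μ}(q,t) = Q_{λ/μ}(-1)`, the plethystic evaluation `p_r ↦ -1`. -/
def ksM (q t : F) (P : Partition → Sym F) (lam mu : Partition) : F :=
  MvPolynomial.eval (fun _ => (-1 : F)) (skewQ q t P lam mu)

/-- the finite `q`-Pochhammer symbol `(a;q)_k = ∏_{j=0}^{k-1}(1 - a q^j)`. -/
def qPochN (qq a : F) (k : ℕ) : F := ∏ j ∈ Finset.range k, (1 - a * qq ^ j)

/-- the `q`-Pochhammer symbol `(a;q)_k = (a;q)_∞/(a q^k;q)_∞` for `k ∈ ℤ`;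
for `k = -m < 0` it equals `1/∏_{i=1}^m (1 - a q^{-i})`. -/
def qPochZ (qq a : F) (k : ℤ) : F :=
  if 0 ≤ k then qPochN qq a k.toNat
  else (∏ j ∈ Finset.range (-k).toNat, (1 - a * (qq⁻¹) ^ (j + 1)))⁻¹

/-- `(a)_λ = (a;q,t)_λ = ∏_{i ≥ 1} (a t^{1-i}; q)_{λ_i}`. -/
def qtPoch (qq tt a : F) (lam : Partition) : F :=
  ∏ j ∈ lam.part.support, qPochN qq (a * tt ^ (-(j : ℤ))) (lam.part j)

/-- the degree (as a symmetric function) of a power-sum exponent vector. -/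
def wt (d : ℕ →₀ ℕ) : ℕ := d.sum fun n m => (n + 1) * m

/-- the degree-`r` homogeneous component of `∏_x (bx;q)_∞/(ax;q)_∞`, namely
`∑_{|κ| = r} z_κ⁻¹ ∏_i (a^{κ_i} - b^{κ_i})/(1 - q^{κ_i}) · p_κ`. -/
def prodComp (a b qq : F) (r : ℕ) : Sym F :=
  ∑ᶠ (k : Partition) (_ : k.size = r),
    ((k.zee : F)⁻¹ *
        ∏ j ∈ k.part.support,
          (a ^ k.part j - b ^ k.part j) / (1 - qq ^ k.part j)) • (pprod k : Sym F)

/-- `∏_x (bx;q)_∞/(ax;q)_∞`, where `(cx;q)_∞ = ∏_{j ≥ 0}(1 - cx q^j)`, as a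
formal power series in the power sums. -/
def prodSeries (a b qq : F) : MvPowerSeries ℕ F :=
  fun d => MvPolynomial.coeff d (prodComp a b qq (wt d))

/-- the formal (possibly infinite) sum `∑_i c_i g_i` of symmetric functions,
as a formal power series in the power sums. -/
def sumSeries {ι : Type*} (c : ι → F) (g : ι → Sym F) : MvPowerSeries ℕ F :=
  fun d => ∑ᶠ i : ι, c i * MvPolynomial.coeff d (g i)

/-- `ℚ(t)` -/
abbrev F1 : Type := RatFunc ℚ
/-- `ℚ(t)(q)` -/
abbrev F2 : Type := RatFunc F1
/-- `ℚ(t)(q)(a)` -/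
abbrev F3 : Type := RatFunc F2
/-- `ℚ(t)(q)(a)(b)` -/
abbrev F4 : Type := RatFunc F3

instance : Field F2 := inferInstance
instance : Field F3 := inferInstance
instance : Field F4 := inferInstance

/-- the indeterminate `t` in `ℚ(t)`. -/
def t1 : F1 := RatFunc.X
/-- the indeterminate `q` in `ℚ(t)(q)`. -/
def q2 : F2 := RatFunc.X
/-- the indeterminate `t` in `ℚ(t)(q)`. -/
def t2 : F2 := RatFunc.C t1
/-- the indeterminate `a` in `ℚ(t)(q)(a)`. -/
def a3 : F3 := RatFunc.X
/-- the indeterminate `q` in `ℚ(t)(q)(a)`. -/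
def q3 : F3 := RatFunc.C q2
/-- the indeterminate `t` in `ℚ(t)(q)(a)`. -/
def t3 : F3 := RatFunc.C t2
/-- the indeterminate `b` in `ℚ(t)(q)(a)(b)`. -/
def b4 : F4 := RatFunc.X
/-- the indeterminate `a` in `ℚ(t)(q)(a)(b)`. -/
def a4 : F4 := RatFunc.C a3
/-- the indeterminate `q` in `ℚ(t)(q)(a)(b)`. -/
def q4 : F4 := RatFunc.C q3
/-- the indeterminate `t` in `ℚ(t)(q)(a)(b)`. -/
def t4 : F4 := RatFunc.C t3


section
/-! ### The bilinear form -/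

/-- the norm of a power sum monomial for general weights -/
def zw (w : ℕ → F) (d : ℕ →₀ ℕ) : F :=
  d.prod fun n m => (((n : F) + 1) ^ m * (Nat.factorial m : F)) * (w n) ^ m

/-- the bilinear form on symmetric functions with general weights -/
def ip (w : ℕ → F) : Sym F →ₗ[F] Sym F →ₗ[F] F :=
  (MvPolynomial.basisMonomials ℕ F).constr F
    (fun d => (zw w d) • (MvPolynomial.lcoeff F d))

lemma ip_apply (w : ℕ → F) (f g : Sym F) :
    ip w f g = ∑ d ∈ f.support, f.coeff d * g.coeff d * zw w d := by
  rw [ip, Module.Basis.constr_apply]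
  rw [Finsupp.sum, LinearMap.sum_apply]
  apply Finset.sum_congr rfl
  intro d _
  simp only [LinearMap.smul_apply, smul_eq_mul, MvPolynomial.lcoeff_apply]
  rw [show ((MvPolynomial.basisMonomials ℕ F).repr f) d = f.coeff d from rfl]
  ring

lemma innerQT_eq (q t : F) (f g : Sym F) :
    innerQT q t f g = ip (fun n => (1 - q ^ (n + 1)) / (1 - t ^ (n + 1))) f g := by
  rw [ip_apply]; rfl

lemma ip_monomial_left (w : ℕ → F) (d : ℕ →₀ ℕ) (c : F) (g : Sym F) :
    ip w (MvPolynomial.monomial d c) g = c * (g.coeff d * zw w d) := by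
  classical
  rw [ip_apply, MvPolynomial.support_monomial]
  split_ifs with h
  · simp [h]
  · simp [mul_assoc]

lemma ip_monomial_monomial (w : ℕ → F) (d e : ℕ →₀ ℕ) :
    ip w (MvPolynomial.monomial d 1) (MvPolynomial.monomial e 1) =
      if e = d then zw w d else 0 := by
  classical
  rw [ip_monomial_left, MvPolynomial.coeff_monomial]
  split_ifs <;> simp

lemma sym_hom_ext {M : Type*} [AddCommMonoid M] [Module F M] {f g : Sym F →ₗ[F] M}
    (h : ∀ d, f (MvPolynomial.monomial d 1) = g (MvPolynomial.monomial d 1)) : f = g := by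
  apply (MvPolynomial.basisMonomials ℕ F).ext
  intro d
  simpa using h d

lemma ip_comm (w : ℕ → F) (f g : Sym F) : ip w f g = ip w g f := by
  have : ip w = (ip w).flip := by
    apply sym_hom_ext
    intro d
    apply sym_hom_ext
    intro e
    rw [LinearMap.flip_apply, ip_monomial_monomial, ip_monomial_monomial]
    by_cases h : e = d
    · simp [h]
    · simp [h, Ne.symm h]
  conv_lhs => rw [this]
  rfl

lemma zw_ne_zero [CharZero F] {w : ℕ → F} (hw : ∀ n, w n ≠ 0) (d : ℕ →₀ ℕ) : zw w d ≠ 0 := by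
  rw [zw, Finsupp.prod, Finset.prod_ne_zero_iff]
  intro n _
  refine mul_ne_zero (mul_ne_zero (pow_ne_zero _ ?_) ?_) (pow_ne_zero _ (hw n))
  · exact_mod_cast Nat.succ_ne_zero n
  · exact_mod_cast Nat.factorial_ne_zero _

lemma ip_nondeg [CharZero F] {w : ℕ → F} (hw : ∀ n, w n ≠ 0) {f : Sym F}
    (h : ∀ g, ip w f g = 0) : f = 0 := by
  ext d
  have := h (MvPolynomial.monomial d 1)
  rw [ip_comm, ip_monomial_left] at this
  simpa [zw_ne_zero hw d] using this

lemma zw_add_single (w : ℕ → F) (d : ℕ →₀ ℕ) (n : ℕ) :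
    zw w (d + Finsupp.single n 1) = ((n : F) + 1) * w n * ((d n : F) + 1) * zw w d := by
  classical
  have h1 : ∀ e : ℕ →₀ ℕ, zw w e = (((n : F) + 1) ^ (e n) * (Nat.factorial (e n) : F)) * (w n) ^ (e n)
      * zw w (e.erase n) := by
    intro e
    rw [zw, zw]
    by_cases hn : n ∈ e.support
    · rw [← Finsupp.mul_prod_erase e n _ hn]
    · rw [Finsupp.notMem_support_iff] at hn
      rw [hn, Finsupp.erase_of_notMem_support (by simpa using hn)]
      simp
  rw [h1 (d + Finsupp.single n 1), h1 d]
  have : (d + Finsupp.single n 1).erase n = d.erase n := by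
    ext k
    by_cases hk : k = n
    · simp [hk]
    · simp [hk, Finsupp.single_apply, Ne.symm hk]
  rw [this]
  simp only [Finsupp.add_apply, Finsupp.single_eq_same, Nat.factorial_succ]
  push_cast
  ring

lemma ip_X_mul (w : ℕ → F) (n : ℕ) (f g : Sym F) :
    ip w f (MvPolynomial.X n * g) = ((n : F) + 1) * w n * ip w (MvPolynomial.pderiv n f) g := by
  classical
  have : (ip w).compl₂ (LinearMap.mulLeft F (MvPolynomial.X n : Sym F)) =
      (((n : F) + 1) * w n) • ((ip w).comp (MvPolynomial.pderiv n).toLinearMap) := by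
    apply sym_hom_ext
    intro d
    apply sym_hom_ext
    intro e
    simp only [LinearMap.compl₂_apply, LinearMap.mulLeft_apply, LinearMap.smul_apply,
      LinearMap.comp_apply, Derivation.coeFn_coe, smul_eq_mul]
    rw [MvPolynomial.pderiv_monomial]
    rw [MvPolynomial.X, MvPolynomial.monomial_mul, mul_one, ip_monomial_monomial, ip_monomial_left,
      MvPolynomial.coeff_monomial, one_mul]
    by_cases h : Finsupp.single n 1 + e = d
    · subst h
      rw [if_pos rfl, add_comm, zw_add_single]
      simp
      ring
    · rw [if_neg h]
      by_cases h0 : d n = 0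
      · simp [h0]
      · rw [if_neg]
        · simp
        · rintro rfl
          apply h
          ext k
          by_cases hk : k = n
          · subst hk; simp; omega
          · simp [Ne.symm hk, Finsupp.single_apply]
  exact congrArg (fun l => l f g) this

/-! ### The elements `K_r` and the shift operators -/

/-- the degree `r` part of `exp (∑ c_k p_{k+1} / (k+1))` -/
def Kel (c : ℕ → F) : ℕ → Sym F
  | 0 => 1
  | r + 1 => ((r : F) + 1)⁻¹ • ∑ k : Fin (r + 1), c k • (MvPolynomial.X (k : ℕ) * Kel c (r - k))

lemma Kel_zero (c : ℕ → F) : Kel c 0 = 1 := by rw [Kel]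

lemma Kel_rec [CharZero F] (c : ℕ → F) (r : ℕ) :
    (r : F) • Kel c r =
      ∑ k ∈ Finset.range r, c k • (MvPolynomial.X k * Kel c (r - 1 - k)) := by
  cases r with
  | zero => simp
  | succ r =>
    rw [Kel, Finset.sum_range (n := r + 1), smul_smul]
    have : ((r + 1 : ℕ) : F) * ((r : F) + 1)⁻¹ = 1 := by
      push_cast
      exact mul_inv_cancel₀ (by exact_mod_cast Nat.succ_ne_zero r)
    rw [this, one_smul]
    simp

/-- weights of the power sums -/
abbrev wts : ℕ → ℕ := fun n => n + 1

/-- homogeneity -/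
abbrev Hom (f : Sym F) (d : ℕ) : Prop := MvPolynomial.IsWeightedHomogeneous wts f d

lemma Hom.smul {f : Sym F} {d : ℕ} (h : Hom f d) (c : F) : Hom (c • f) d := by
  rw [MvPolynomial.smul_eq_C_mul]; exact h.C_mul c

lemma Kel_hom (c : ℕ → F) (r : ℕ) : Hom (Kel c r) r := by
  induction r using Nat.strong_induction_on with
  | _ r ih =>
    cases r with
    | zero => rw [Kel]; exact MvPolynomial.isWeightedHomogeneous_one _ _
    | succ r =>
      rw [Kel]
      apply Hom.smul
      apply MvPolynomial.IsWeightedHomogeneous.sum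
      intro k _
      apply Hom.smul
      have := (MvPolynomial.isWeightedHomogeneous_X F wts (k : ℕ)).mul (ih (r - k) (by omega))
      have h2 : wts (k : ℕ) + (r - k) = r + 1 := by
        have := k.2; simp only [wts]; omega
      rwa [h2] at this

/-- the shift `p_k ↦ p_k + v_k x^k` -/
def psi (v : ℕ → F) : Sym F →ₐ[F] Polynomial (Sym F) :=
  MvPolynomial.aeval fun n => Polynomial.C (MvPolynomial.X n) +
    Polynomial.C (MvPolynomial.C (v n)) * Polynomial.X ^ (n + 1)

/-- its coefficients -/
def Sop (v : ℕ → F) (r : ℕ) : Sym F →ₗ[F] Sym F :=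
  ((Polynomial.lcoeff (Sym F) r).restrictScalars F).comp (psi v).toLinearMap

lemma Sop_apply (v : ℕ → F) (r : ℕ) (f : Sym F) : Sop v r f = (psi v f).coeff r := rfl

lemma psi_X (v : ℕ → F) (n : ℕ) : psi v (MvPolynomial.X n) = Polynomial.C (MvPolynomial.X n) +
    Polynomial.C (MvPolynomial.C (v n)) * Polynomial.X ^ (n + 1) := by
  simp [psi]

lemma Sop_zero (v : ℕ → F) (f : Sym F) : Sop v 0 f = f := by
  rw [Sop_apply, Polynomial.coeff_zero_eq_aeval_zero]
  have : ((Polynomial.aeval (0 : Sym F)).restrictScalars F).comp (psi v) = AlgHom.id F (Sym F) := by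
    apply MvPolynomial.algHom_ext
    intro n
    simp [psi_X]
  exact congrArg (fun l => l f) this

lemma psi_C (v : ℕ → F) (a : F) : psi v (MvPolynomial.C a) = Polynomial.C (MvPolynomial.C a) := by
  simp [psi]

lemma psi_deriv_dvd (v : ℕ → F) (R : ℕ) (f : Sym F) :
    (Polynomial.X : Polynomial (Sym F)) ^ (R + 1) ∣
      Polynomial.X * Polynomial.derivative (psi v f) -
        ∑ n ∈ Finset.range R, Polynomial.C (MvPolynomial.C (((n : F) + 1) * v n)) *
          Polynomial.X ^ (n + 1) * psi v (MvPolynomial.pderiv n f) := by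
  induction f using MvPolynomial.induction_on with
  | C a => simp [psi_C]
  | add p q hp hq =>
    have := dvd_add hp hq
    convert this using 1
    simp only [map_add, mul_add, Finset.sum_add_distrib]
    ring
  | mul_X p n hp =>
    have hX : (Polynomial.X : Polynomial (Sym F)) ^ (R + 1) ∣
      Polynomial.X * Polynomial.derivative (psi v (MvPolynomial.X n)) -
        ∑ k ∈ Finset.range R, Polynomial.C (MvPolynomial.C (((k : F) + 1) * v k)) *
          Polynomial.X ^ (k + 1) * psi v (MvPolynomial.pderiv k (MvPolynomial.X n)) := by
      have e1 : Polynomial.X * Polynomial.derivative (psi v (MvPolynomial.X n)) =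
          Polynomial.C (MvPolynomial.C (((n : F) + 1) * v n)) * Polynomial.X ^ (n + 1) := by
        rw [psi_X]
        simp only [Polynomial.derivative_add, Polynomial.derivative_C, zero_add,
          Polynomial.derivative_C_mul, Polynomial.derivative_X_pow, map_mul, map_add,
          map_natCast, map_one]
        push_cast
        ring
      have e2 : ∀ k, psi v (MvPolynomial.pderiv k (MvPolynomial.X n)) = if k = n then 1 else 0 := by
        intro k
        by_cases h : k = n
        · subst h; simp
        · rw [MvPolynomial.pderiv_X_of_ne (Ne.symm h)]; simp [h]
      rw [e1]
      simp only [e2, mul_ite, mul_one, mul_zero, Finset.sum_ite_eq', Finset.mem_range]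
      split_ifs with h
      · simp
      · rw [sub_zero]
        exact Dvd.dvd.mul_left (pow_dvd_pow _ (by omega)) _
    have := dvd_add (hp.mul_right (psi v (MvPolynomial.X n))) (hX.mul_right (psi v p))
    convert this using 1
    simp only [map_mul, Derivation.leibniz, smul_eq_mul, map_add, mul_add, Finset.sum_add_distrib,
      sub_mul, Finset.sum_mul, Polynomial.derivative_mul]
    have h1 : ∀ (a b c d : Polynomial (Sym F)), a * b * (c * d) = a * b * d * c := by
      intros; ring
    simp only [h1, Finset.sum_add_distrib]
    ring

lemma Sop_rec (v : ℕ → F) (r : ℕ) (f : Sym F) :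
    (r : F) • Sop v r f =
      ∑ k ∈ Finset.range r, (((k : F) + 1) * v k) • Sop v (r - 1 - k) (MvPolynomial.pderiv k f) := by
  obtain ⟨g, hg⟩ := psi_deriv_dvd v r f
  have := congrArg (fun p => Polynomial.coeff p r) hg
  rw [Polynomial.coeff_X_pow_mul', if_neg (by omega), Polynomial.coeff_sub, sub_eq_zero] at this
  have hl : (Polynomial.X * Polynomial.derivative (psi v f)).coeff r = (r : F) • Sop v r f := by
    cases r with
    | zero => simp
    | succ r =>
      rw [Polynomial.coeff_X_mul, Polynomial.coeff_derivative, Sop_apply,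
        MvPolynomial.smul_eq_C_mul]
      simp
      ring
  rw [← hl, this, Polynomial.finset_sum_coeff]
  apply Finset.sum_congr rfl
  intro k hk
  rw [Finset.mem_range] at hk
  rw [mul_assoc, Polynomial.coeff_C_mul, Polynomial.coeff_X_pow_mul', if_pos (by omega), Sop_apply,
    MvPolynomial.smul_eq_C_mul]
  rw [show r - 1 - k = r - (k + 1) by omega]

/-- The fundamental adjointness. -/
lemma ip_Kel_mul [CharZero F] {w c v : ℕ → F} (h : ∀ k, c k * w k = v k) (r : ℕ) (f g : Sym F) :
    ip w f (Kel c r * g) = ip w (Sop v r f) g := by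
  induction r using Nat.strong_induction_on generalizing f g with
  | _ r ih =>
    rcases Nat.eq_zero_or_pos r with rfl | hr
    · rw [Kel_zero, Sop_zero, one_mul]
    · have hr' : (r : F) ≠ 0 := by exact_mod_cast hr.ne'
      apply mul_left_cancel₀ hr'
      have e1 : (r : F) * ip w f (Kel c r * g) = ip w f (((r : F) • Kel c r) * g) := by
        rw [smul_mul_assoc, map_smul, smul_eq_mul]
      have e2 : (r : F) * ip w (Sop v r f) g = ip w ((r : F) • Sop v r f) g := by
        rw [map_smul, LinearMap.smul_apply, smul_eq_mul]
      rw [e1, e2, Kel_rec, Sop_rec, Finset.sum_mul, map_sum, map_sum, LinearMap.sum_apply]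
      apply Finset.sum_congr rfl
      intro k hk
      rw [Finset.mem_range] at hk
      rw [smul_mul_assoc, map_smul, map_smul, LinearMap.smul_apply, mul_assoc, ip_X_mul,
        ih _ (by omega), smul_eq_mul, smul_eq_mul, ← h k]
      ring

/-! ### homogeneity and the form -/

lemma ip_hom_ne {w : ℕ → F} {f g : Sym F} {a b : ℕ} (hf : Hom f a) (hg : Hom g b) (h : a ≠ b) :
    ip w f g = 0 := by
  rw [ip_apply]
  apply Finset.sum_eq_zero
  intro d hd
  have h1 := hf (MvPolynomial.mem_support_iff.mp hd)
  have : g.coeff d = 0 := by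
    by_contra h2
    exact h (h1.symm.trans (hg h2))
  simp [this]

lemma hom_of_ip [CharZero F] {w : ℕ → F} (hw : ∀ n, w n ≠ 0) {f : Sym F} {a : ℕ}
    (h : ∀ b g, Hom g b → b ≠ a → ip w f g = 0) : Hom f a := by
  intro d hd
  by_contra hne
  have := h _ (MvPolynomial.monomial d 1)
    (MvPolynomial.isWeightedHomogeneous_monomial wts d 1 rfl) hne
  rw [ip_comm, ip_monomial_left, one_mul] at this
  exact mul_ne_zero hd (zw_ne_zero hw d) this

lemma ip_component {w : ℕ → F} {f g : Sym F} {b : ℕ} (hg : Hom g b) :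
    ip w (MvPolynomial.weightedHomogeneousComponent wts b f) g = ip w f g := by
  rw [ip_comm, ip_comm w f, ip_apply, ip_apply]
  apply Finset.sum_congr rfl
  intro d hd
  rw [MvPolynomial.coeff_weightedHomogeneousComponent,
    if_pos (hg (MvPolynomial.mem_support_iff.mp hd))]

lemma Sop_hom [CharZero F] {v : ℕ → F} {f : Sym F} {a r : ℕ} (hf : Hom f (a + r)) :
    Hom (Sop v r f) a := by
  have hw : ∀ n : ℕ, (fun _ => (1 : F)) n ≠ 0 := by simp
  apply hom_of_ip hw
  intro b g hg hb
  rw [← ip_Kel_mul (c := v) (w := fun _ => 1) (v := v) (by simp)]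
  exact ip_hom_ne hf ((Kel_hom v r).mul hg) (by omega)

lemma Sop_eq_zero [CharZero F] {v : ℕ → F} {f : Sym F} {a r : ℕ} (hf : Hom f a) (h : a < r) :
    Sop v r f = 0 := by
  have hw : ∀ n : ℕ, (fun _ => (1 : F)) n ≠ 0 := by simp
  apply ip_nondeg hw
  intro g
  rw [← ip_Kel_mul (c := v) (w := fun _ => 1) (v := v) (by simp)]
  have : ∀ b, ip (fun _ => (1 : F)) f (Kel v r * MvPolynomial.weightedHomogeneousComponent wts b g) = 0 := by
    intro b
    exact ip_hom_ne hf ((Kel_hom v r).mul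
      (MvPolynomial.weightedHomogeneousComponent_isWeightedHomogeneous _ _)) (by omega)
  rw [← MvPolynomial.sum_weightedHomogeneousComponent wts g, finsum_eq_sum _
    (MvPolynomial.weightedHomogeneousComponent_finsupp g), Finset.mul_sum, map_sum]
  exact Finset.sum_eq_zero fun b _ => this b

/-! ### Evaluations in finitely many variables -/

/-- `p_{k+1} ↦ ∑ θ_i(k) u_i^{k+1}` -/
def phi {L : ℕ} (θ : Fin L → ℕ → F) : Sym F →ₐ[F] MvPolynomial (Fin L) F :=
  MvPolynomial.aeval fun k => ∑ i, MvPolynomial.C (θ i k) * MvPolynomial.X i ^ (k + 1)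

lemma phi_X {L : ℕ} (θ : Fin L → ℕ → F) (k : ℕ) :
    phi θ (MvPolynomial.X k) = ∑ i, MvPolynomial.C (θ i k) * MvPolynomial.X i ^ (k + 1) := by
  simp [phi]

lemma phi_succ {L : ℕ} (θ : Fin (L + 1) → ℕ → F) (f : Sym F) :
    MvPolynomial.finSuccEquiv F L (phi θ f) =
      (psi (θ 0) f).map (phi (fun i : Fin L => θ i.succ)).toRingHom := by
  have : (MvPolynomial.finSuccEquiv F L).toAlgHom.comp (phi θ) =
      (Polynomial.mapAlgHom (phi (fun i : Fin L => θ i.succ))).comp (psi (θ 0)) := by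
    apply MvPolynomial.algHom_ext
    intro k
    simp only [AlgHom.comp_apply, AlgHom.coe_coe,
      phi_X, psi_X, Fin.sum_univ_succ, map_add, map_mul, map_pow, map_sum,
      MvPolynomial.finSuccEquiv_X_zero, MvPolynomial.finSuccEquiv_X_succ]
    simp [MvPolynomial.finSuccEquiv_apply, phi_X]
    rw [add_comm]
  exact congrArg (fun l => l f) this

lemma coeff_phi [CharZero F] {w : ℕ → F} {L : ℕ} (θ c : Fin L → ℕ → F)
    (h : ∀ i k, c i k * w k = θ i k) (m : Fin L →₀ ℕ) (f : Sym F) :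
    (phi θ f).coeff m = ip w f (∏ i, Kel (c i) (m i)) := by
  induction L generalizing f with
  | zero =>
    have hm : m = 0 := Subsingleton.elim _ _
    subst hm
    simp only [Finset.univ_eq_empty, Finset.prod_empty]
    rw [ip_comm, show (1 : Sym F) = MvPolynomial.monomial 0 1 from rfl, ip_monomial_left]
    have : zw w 0 = 1 := by simp [zw]
    rw [this, one_mul, mul_one]
    have : phi θ f = MvPolynomial.C (MvPolynomial.constantCoeff f) := by
      have : phi θ = (MvPolynomial.aeval (fun _ => 0)) := by
        apply MvPolynomial.algHom_ext
        intro k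
        simp [phi_X]
      rw [this, MvPolynomial.aeval_zero']
      rfl
    rw [this]
    simp [MvPolynomial.constantCoeff_eq]
  | succ L ih =>
    obtain ⟨i, m', rfl⟩ : ∃ i m', m = Finsupp.cons i m' :=
      ⟨m 0, m.tail, (Finsupp.cons_tail m).symm⟩
    rw [← MvPolynomial.finSuccEquiv_coeff_coeff, phi_succ, Polynomial.coeff_map]
    have := ih (fun i : Fin L => θ i.succ) (fun i => c i.succ) (fun i k => h i.succ k) m'
      (Sop (θ 0) i f)
    rw [Sop_apply] at this
    rw [Fin.prod_univ_succ, Finsupp.cons_zero, ip_Kel_mul (h 0)]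
    simp only [Finsupp.cons_succ]
    exact this

end

section
/-! ### Partitions and complete symmetric functions -/

lemma lower_eq_range (S : Finset ℕ) (h : ∀ i j, i ≤ j → j ∈ S → i ∈ S) : S = Finset.range S.card := by
  have hex : ∃ n, n ∉ S := Infinite.exists_notMem_finset S
  classical
  have : S = Finset.range (Nat.find hex) := by
    ext x
    rw [Finset.mem_range]
    constructor
    · intro hx
      by_contra hlt
      exact Nat.find_spec hex (h _ _ (not_lt.mp hlt) hx)
    · intro hx
      by_contra hc
      exact absurd hx (not_lt.mpr (Nat.find_min' hex hc))
  rw [this, Finset.card_range]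

lemma Partition.ext' {a b : Partition} (h : ∀ j, a.part j = b.part j) : a = b := by
  cases a; cases b
  congr
  ext j
  exact h j

lemma le_part_iff (lam : Partition) {i : ℕ} (hi : 1 ≤ i) (j : ℕ) :
    i ≤ lam.part j ↔ j < lam.conj i := by
  have := lower_eq_range (lam.part.support.filter fun j => i ≤ lam.part j) (by
    intro a b hab hb
    simp only [Finset.mem_filter, Finsupp.mem_support_iff] at hb ⊢
    have := lam.antitone' hab
    omega)
  rw [Partition.conj, ← Finset.mem_range, ← this]
  simp only [Finset.mem_filter, Finsupp.mem_support_iff]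
  omega

lemma conj_succ (lam : Partition) (i : ℕ) : lam.conj i = lam.mult i + lam.conj (i + 1) := by
  rw [Partition.conj, Partition.mult, Partition.conj, ← Finset.card_union_of_disjoint]
  · congr 1
    ext j
    simp only [Finset.mem_filter, Finset.mem_union]
    constructor
    · rintro ⟨h1, h2⟩
      by_cases h : lam.part j = i
      · exact Or.inl ⟨h1, h⟩
      · exact Or.inr ⟨h1, by omega⟩
    · rintro (⟨h1, h2⟩ | ⟨h1, h2⟩)
      · exact ⟨h1, by omega⟩
      · exact ⟨h1, by omega⟩
  · rw [Finset.disjoint_filter]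
    intro j _ h1 h2
    omega

lemma conj_big (lam : Partition) {i : ℕ} (h : lam.part 0 < i) : lam.conj i = 0 := by
  by_contra hc
  have := (le_part_iff lam (by omega : 1 ≤ i) 0).mpr (by omega)
  omega

/-- exponent vector of `p_λ` -/
def mfun (lam : Partition) : ℕ →₀ ℕ := ∑ j ∈ lam.part.support, Finsupp.single (lam.part j - 1) 1

lemma mfun_apply (lam : Partition) (n : ℕ) : mfun lam n = lam.mult (n + 1) := by
  classical
  rw [mfun, Finsupp.finsetSum_apply, Partition.mult, Finset.card_filter]
  apply Finset.sum_congr rfl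
  intro j hj
  rw [Finsupp.single_apply]
  rw [Finsupp.mem_support_iff] at hj
  by_cases h : lam.part j = n + 1
  · simp [h]
  · rw [if_neg h, if_neg (by omega)]

lemma mfun_inj {a b : Partition} (h : mfun a = mfun b) : a = b := by
  have hm : ∀ i, 1 ≤ i → a.mult i = b.mult i := by
    intro i hi
    obtain ⟨n, rfl⟩ := Nat.exists_eq_add_of_le' hi
    rw [← mfun_apply, ← mfun_apply, h]
  have hc : ∀ k i, 1 ≤ i → a.part 0 + b.part 0 < i + k → a.conj i = b.conj i := by
    intro k
    induction k with
    | zero =>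
      intro i hi h
      rw [conj_big a (by omega), conj_big b (by omega)]
    | succ k ih =>
      intro i hi h
      rw [conj_succ a, conj_succ b, hm i hi, ih (i + 1) (by omega) (by omega)]
  have hc' : ∀ i, 1 ≤ i → a.conj i = b.conj i := fun i hi =>
    hc (a.part 0 + b.part 0 + 1) i hi (by omega)
  apply Partition.ext'
  intro j
  apply le_antisymm
  · rcases Nat.eq_zero_or_pos (a.part j) with h0 | h0
    · omega
    · exact (le_part_iff b h0 j).mpr (by rw [← hc' _ h0]; exact (le_part_iff a h0 j).mp le_rfl)
  · rcases Nat.eq_zero_or_pos (b.part j) with h0 | h0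
    · omega
    · exact (le_part_iff a h0 j).mpr (by rw [hc' _ h0]; exact (le_part_iff b h0 j).mp le_rfl)

lemma mfun_surj (d : ℕ →₀ ℕ) : ∃ a, mfun a = d := by
  classical
  obtain ⟨N, hN⟩ : ∃ N, ∀ n, N ≤ n → d n = 0 := by
    refine ⟨d.support.sup id + 1, fun n hn => ?_⟩
    by_contra h
    have := Finset.le_sup (f := id) (Finsupp.mem_support_iff.mpr h)
    simp only [id] at this
    omega
  let c : ℕ → ℕ := fun i => ∑ n ∈ Finset.Ico i N, d n
  have hc : ∀ i, c i = d i + c (i + 1) := by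
    intro i
    by_cases h : i < N
    · simp only [c]; rw [Finset.sum_eq_sum_Ico_succ_bot h]
    · have h1 : Finset.Ico i N = ∅ := Finset.Ico_eq_empty h
      have h2 : Finset.Ico (i + 1) N = ∅ := Finset.Ico_eq_empty (by omega)
      simp [c, h1, h2, hN i (by omega)]
  have hanti : Antitone c := antitone_nat_of_succ_le fun n => by rw [hc n]; omega
  have hcN : ∀ i, N ≤ i → c i = 0 := by
    intro i hi
    simp only [c, Finset.Ico_eq_empty (show ¬ i < N by omega), Finset.sum_empty]
  let g : ℕ → ℕ := fun j => ((Finset.range N).filter fun i => j < c i).card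
  have hg : ∀ i j, i < g j ↔ j < c i := by
    intro i j
    have := lower_eq_range ((Finset.range N).filter fun i => j < c i) (by
      intro a b hab hb
      simp only [Finset.mem_filter, Finset.mem_range] at hb ⊢
      have := hanti hab
      omega)
    rw [← Finset.mem_range, ← this]
    simp only [Finset.mem_filter, Finset.mem_range]
    constructor
    · exact fun h => h.2
    · intro h
      refine ⟨?_, h⟩
      by_contra hh
      rw [hcN i (by omega)] at h
      omega
  let a : Partition := ⟨Finsupp.onFinset (Finset.range (c 0)) g (by
      intro j hj
      rw [Finset.mem_range]
      exact (hg 0 j).mp (by omega)), by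
      intro i j hij
      simp only [Finsupp.onFinset_apply]
      by_contra hlt
      push Not at hlt
      have h1 := (hg _ _).mp hlt
      have := (hg (g i) i).mpr (by omega)
      omega⟩
  have hconj : ∀ i, a.conj (i + 1) = c i := by
    intro i
    have key : ∀ j, j < a.conj (i + 1) ↔ j < c i := by
      intro j
      rw [← le_part_iff a (by omega), ← hg]
      exact Iff.rfl
    have h1 := key (c i)
    have h2 := key (a.conj (i + 1))
    omega
  refine ⟨a, ?_⟩
  ext n
  rw [mfun_apply]
  have h1 := conj_succ a (n + 1)
  rw [hconj, hconj] at h1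
  have := hc n
  omega

lemma pprod_eq (lam : Partition) : (pprod lam : Sym F) = MvPolynomial.monomial (mfun lam) 1 := by
  rw [pprod, mfun, MvPolynomial.monomial_sum_one]
  rfl

lemma wt_mfun (lam : Partition) : wt (mfun lam) = lam.size := by
  have hadd : ∀ a b, wt (a + b) = wt a + wt b := by
    intro a b
    rw [wt, Finsupp.sum_add_index']
    · rfl
    · simp
    · intros; ring
  have : ∀ S : Finset ℕ, wt (∑ j ∈ S, Finsupp.single (lam.part j - 1) 1) =
      ∑ j ∈ S, wt (Finsupp.single (lam.part j - 1) 1) := by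
    intro S
    classical
    induction S using Finset.induction_on with
    | empty => simp [wt]
    | insert a S ha ih => rw [Finset.sum_insert ha, Finset.sum_insert ha, hadd, ih]
  rw [mfun, this, Partition.size, Finsupp.sum]
  apply Finset.sum_congr rfl
  intro j hj
  rw [Finsupp.mem_support_iff] at hj
  rw [wt, Finsupp.sum_single_index (by simp)]
  omega

lemma zee_eq (lam : Partition) : (lam.zee : F) = zw (fun _ => 1) (mfun lam) := by
  rw [zw, Finsupp.prod, Partition.zee]
  push_cast
  rw [Finset.prod_subset (s₁ := (mfun lam).support) (s₂ := Finset.range (lam.part 0))]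
  rotate_left
  · intro n hn
    rw [Finsupp.mem_support_iff, mfun_apply] at hn
    rw [Finset.mem_range]
    by_contra h
    have := conj_succ lam (n + 1)
    rw [conj_big lam (by omega : lam.part 0 < n + 1)] at this
    omega
  · intro n _ hn
    rw [Finsupp.notMem_support_iff] at hn
    simp [hn]
  rw [← Finset.Ico_succ_right_eq_Icc, Finset.prod_Ico_eq_prod_range]
  apply Finset.prod_congr
  · simp
  · intro n _
    rw [mfun_apply]
    push_cast
    rw [add_comm 1 n, add_comm (1 : F)]
    simp

lemma size_finite (r : ℕ) : {k : Partition | k.size = r}.Finite := by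
  classical
  have hfin : {d : ℕ →₀ ℕ | wt d = r}.Finite := by
    apply (Set.finite_Iic (∑ n ∈ Finset.range r, Finsupp.single n r)).subset
    intro d hd
    rw [Set.mem_Iic]
    intro n
    rw [Finsupp.finsetSum_apply]
    rcases Nat.eq_zero_or_pos (d n) with h | h
    · omega
    · have h1 : (n + 1) * d n ≤ r := by
        rw [← (hd : wt d = r), wt, Finsupp.sum]
        exact Finset.single_le_sum (f := fun n => (n + 1) * d n) (fun _ _ => Nat.zero_le _)
          (Finsupp.mem_support_iff.mpr h.ne')
      have h2 : d n ≤ r := by nlinarith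
      have h3 : n < r := by nlinarith
      simp only [Finsupp.single_apply, Finset.sum_ite_eq', Finset.mem_range, h3, if_true]
      exact h2
  apply Set.Finite.of_finite_image (f := mfun)
  · apply hfin.subset
    rintro _ ⟨k, hk, rfl⟩
    exact (wt_mfun k).trans hk
  · intro a _ b _ h
    exact mfun_inj h

lemma coeff_Kel_one [CharZero F] (r : ℕ) (e : ℕ →₀ ℕ) :
    (Kel (fun _ => (1 : F)) r).coeff e = if wt e = r then (zw (fun _ => (1 : F)) e)⁻¹ else 0 := by
  classical
  have hz := zw_ne_zero (F := F) (w := fun _ => 1) (by simp) e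
  have h := coeff_phi (F := F) (w := fun _ => 1) (L := 1) (fun _ _ => 1) (fun _ _ => 1) (by simp)
    (Finsupp.single 0 r) (MvPolynomial.monomial e 1)
  rw [Fin.prod_univ_one, Finsupp.single_eq_same, ip_monomial_left, one_mul] at h
  have h2 : phi (L := 1) (fun _ _ => (1 : F)) (MvPolynomial.monomial e 1) =
      MvPolynomial.X 0 ^ (wt e) := by
    rw [phi, MvPolynomial.aeval_monomial, wt, Finsupp.sum, Finsupp.prod,
      ← Finset.prod_pow_eq_pow_sum]
    simp [pow_mul]
  rw [h2, MvPolynomial.coeff_X_pow] at h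
  rw [eq_div_of_mul_eq hz h.symm]
  by_cases hh : wt e = r
  · simp [hh]
  · rw [if_neg hh, if_neg, zero_div]
    intro h3
    exact hh (by simpa using congrArg (fun l => l 0) h3)

lemma hsym_eq [CharZero F] (r : ℕ) : hsym F r = Kel (fun _ => (1 : F)) r := by
  classical
  rw [hsym]
  rw [show (∑ᶠ (k : Partition) (_ : k.size = r), ((k.zee : F))⁻¹ • (pprod k : Sym F)) =
    ∑ᶠ k ∈ {k : Partition | k.size = r}, ((k.zee : F))⁻¹ • (pprod k : Sym F) from rfl]
  rw [finsum_mem_eq_finite_toFinset_sum _ (size_finite r)]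
  ext e
  rw [coeff_Kel_one, MvPolynomial.coeff_sum]
  obtain ⟨a, rfl⟩ := mfun_surj e
  simp only [MvPolynomial.coeff_smul, pprod_eq, MvPolynomial.coeff_monomial, smul_eq_mul, mul_ite,
    mul_one, mul_zero]
  have : ∀ k, (mfun k = mfun a) = (k = a) := fun k =>
    propext ⟨fun h => mfun_inj h, fun h => by rw [h]⟩
  simp only [this, Finset.sum_ite_eq', Set.Finite.mem_toFinset, Set.mem_ofPred_eq, wt_mfun, zee_eq]

end

section
lemma prod_support_eq {M : Type*} [CommMonoid M] (lam : Partition) {n : ℕ}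
    (h : ∀ j, n ≤ j → lam.part j = 0) (c : ℕ → M) (hc : c 0 = 1) :
    ∏ j ∈ lam.part.support, c (lam.part j) = ∏ i : Fin n, c (lam.part i) := by
  rw [← Finset.prod_range (fun j => c (lam.part j))]
  apply Finset.prod_subset
  · intro j hj
    rw [Finsupp.mem_support_iff] at hj
    rw [Finset.mem_range]
    by_contra hh
    exact hj (h j (by omega))
  · intro j _ hj
    rw [Finsupp.notMem_support_iff] at hj
    rw [hj, hc]

lemma size_eq_psum (lam : Partition) {n : ℕ} (h : ∀ j, n ≤ j → lam.part j = 0) :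
    lam.size = lam.psum n := by
  rw [Partition.size, Finsupp.sum, Partition.psum]
  apply Finset.sum_subset
  · intro j hj
    rw [Finsupp.mem_support_iff] at hj
    rw [Finset.mem_range]
    by_contra hh
    exact hj (h j (by omega))
  · intro j _ hj
    rwa [Finsupp.notMem_support_iff] at hj

lemma psum_le_size (lam : Partition) (k : ℕ) : lam.psum k ≤ lam.size := by
  rw [Partition.size, Finsupp.sum, Partition.psum]
  calc ∑ j ∈ Finset.range k, lam.part j ≤ ∑ j ∈ Finset.range k ∪ lam.part.support, lam.part j :=
        Finset.sum_le_sum_of_subset Finset.subset_union_left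
    _ = ∑ j ∈ lam.part.support, lam.part j := by
        symm
        apply Finset.sum_subset Finset.subset_union_right
        intro j _ hj
        rwa [Finsupp.notMem_support_iff] at hj

lemma part_eq_zero (lam : Partition) {j : ℕ} (h : lam.size ≤ j) : lam.part j = 0 := by
  by_contra hc
  have h1 : ∑ i ∈ Finset.range (j + 1), 1 ≤ lam.psum (j + 1) := by
    apply Finset.sum_le_sum
    intro i hi
    rw [Finset.mem_range] at hi
    have := lam.antitone' (show i ≤ j by omega)
    omega
  have := psum_le_size lam (j + 1)
  simp at h1
  omega

lemma hprod_eq [CharZero F] (mu : Partition) {n : ℕ} (h : ∀ j, n ≤ j → mu.part j = 0) :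
    hprod F mu = ∏ i : Fin n, Kel (fun _ => (1 : F)) (mu.part i) := by
  rw [hprod]
  simp only [hsym_eq]
  exact prod_support_eq mu h (Kel fun _ => (1 : F)) (Kel_zero _)

lemma hprod_hom [CharZero F] (mu : Partition) : Hom (hprod F mu) mu.size := by
  rw [hprod, Partition.size, Finsupp.sum]
  apply MvPolynomial.IsWeightedHomogeneous.prod
  intro j _
  rw [hsym_eq]
  exact Kel_hom _ _

lemma sum_le_range_of_antitone {g : ℕ → ℕ} (hg : ∀ i j, i ≤ j → g j ≤ g i) (S : Finset ℕ) :
    ∑ i ∈ S, g i ≤ ∑ i ∈ Finset.range S.card, g i := by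
  induction S using Finset.induction_on_max with
  | empty => simp
  | insert a S ha ih =>
    have hn : a ∉ S := fun h => lt_irrefl _ (ha a h)
    rw [Finset.sum_insert hn, Finset.card_insert_of_notMem hn, Finset.sum_range_succ]
    have : S.card ≤ a := by
      have : S ⊆ Finset.range a := fun x hx => Finset.mem_range.mpr (ha x hx)
      simpa using Finset.card_le_card this
    have := hg _ _ this
    omega

/-- the partition attached to an antitone tuple -/
def pofFin {n : ℕ} (m : Fin n → ℕ) (hm : Antitone m) : Partition where
  part := Finsupp.onFinset (Finset.range n) (fun j => if h : j < n then m ⟨j, h⟩ else 0) (by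
    intro j hj
    rw [Finset.mem_range]
    by_contra h
    simp [h] at hj)
  antitone' := by
    intro i j hij
    simp only [Finsupp.onFinset_apply]
    split_ifs with h1 h2
    · exact hm hij
    · omega
    · omega
    · omega

lemma pofFin_apply {n : ℕ} (m : Fin n → ℕ) (hm : Antitone m) (i : Fin n) :
    (pofFin m hm).part i = m i := by
  simp [pofFin]

lemma pofFin_zero {n : ℕ} (m : Fin n → ℕ) (hm : Antitone m) {j : ℕ} (h : n ≤ j) :
    (pofFin m hm).part j = 0 := by
  simp [pofFin, h]

lemma exists_sort {n : ℕ} (m : Fin n → ℕ) : ∃ k : Partition, ∃ e : Fin n ≃ Fin n,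
    (∀ j, n ≤ j → k.part j = 0) ∧ (∀ i : Fin n, k.part i = m (e i)) := by
  let e : Fin n ≃ Fin n := Fin.revPerm.trans (Tuple.sort m)
  have hm : Antitone (m ∘ e) := by
    have h := Tuple.monotone_sort m
    intro a b hab
    exact h (Fin.rev_le_rev.mpr hab)
  exact ⟨pofFin _ hm, e, fun j hj => pofFin_zero _ hm hj, fun i => pofFin_apply _ hm i⟩

lemma exists_sort' [CharZero F] {n : ℕ} (m : Fin n → ℕ) : ∃ k : Partition,
    (∀ j, n ≤ j → k.part j = 0) ∧
    (∏ i, Kel (fun _ => (1 : F)) (m i) = hprod F k) ∧ k.size = ∑ i, m i ∧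
    ∀ T : Finset (Fin n), ∑ i ∈ T, m i ≤ k.psum T.card := by
  obtain ⟨k, e, h0, h⟩ := exists_sort m
  refine ⟨k, h0, ?_, ?_, ?_⟩
  · rw [hprod_eq k h0]
    simp only [h]
    rw [Equiv.prod_comp e (fun i => Kel (fun _ => (1 : F)) (m i))]
  · rw [size_eq_psum k h0, Partition.psum, Finset.sum_range]
    simp only [h]
    rw [Equiv.sum_comp e m]
  · intro T
    let S : Finset ℕ := (T.map e.symm.toEmbedding).map Fin.valEmbedding
    have hS : S.card = T.card := by simp [S]
    have := sum_le_range_of_antitone (g := k.part) (fun i j hij => k.antitone' hij) S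
    rw [hS] at this
    refine le_trans (le_of_eq ?_) this
    simp [S, h]

/-- weights for the classical Hall pairing -/
abbrev w1 (F : Type*) [Field F] : ℕ → F := fun _ => 1

lemma Hall_nondeg_list [CharZero F] {f : Sym F}
    (h : ∀ l : List ℕ, ip (w1 F) f ((l.map (Kel (w1 F))).prod) = 0) : f = 0 := by
  have hS : ∀ f : Sym F, (∀ l : List ℕ, ip (w1 F) f ((l.map (Kel (w1 F))).prod) = 0) →
      ∀ r, ∀ l : List ℕ, ip (w1 F) (Sop (w1 F) r f) ((l.map (Kel (w1 F))).prod) = 0 := by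
    intro f hf r l
    rw [← ip_Kel_mul (c := w1 F) (by simp)]
    exact hf (r :: l)
  have hd : ∀ k, ∀ f : Sym F, (∀ l : List ℕ, ip (w1 F) f ((l.map (Kel (w1 F))).prod) = 0) →
      ∀ l : List ℕ, ip (w1 F) (MvPolynomial.pderiv k f) ((l.map (Kel (w1 F))).prod) = 0 := by
    intro k
    induction k using Nat.strong_induction_on with
    | _ k ih =>
      intro f hf l
      have h1 := Sop_rec (w1 F) (k + 1) f
      rw [Finset.sum_range_succ] at h1
      have h2 := congrArg (fun g => ip (w1 F) g ((l.map (Kel (w1 F))).prod)) h1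
      simp only [map_add, map_sum, map_smul, LinearMap.add_apply, LinearMap.sum_apply,
        LinearMap.smul_apply] at h2
      rw [hS f hf, Finset.sum_eq_zero] at h2
      · rw [show k + 1 - 1 - k = 0 by omega, Sop_zero] at h2
        simp only [smul_eq_mul, mul_zero, mul_one, zero_add] at h2
        have hk : (k : F) + 1 ≠ 0 := by exact_mod_cast Nat.succ_ne_zero k
        exact (mul_eq_zero.mp h2.symm).resolve_left hk
      · intro j hj
        rw [Finset.mem_range] at hj
        rw [hS _ (ih j hj f hf), smul_zero]
  apply ip_nondeg (w := w1 F) (by simp)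
  intro g
  induction g using MvPolynomial.induction_on generalizing f with
  | C a =>
    have := h []
    rw [show (MvPolynomial.C a : Sym F) = a • 1 by rw [MvPolynomial.smul_eq_C_mul, mul_one],
      map_smul]
    simp only [List.map_nil, List.prod_nil] at this
    rw [this, smul_zero]
  | add p q hp hq => rw [map_add, hp h, hq h, add_zero]
  | mul_X p n hp => rw [mul_comm, ip_X_mul, hp (hd n f h), mul_zero]

lemma Hall_nondeg [CharZero F] {f : Sym F}
    (h : ∀ k : Partition, ip (w1 F) f (hprod F k) = 0) : f = 0 := by
  apply Hall_nondeg_list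
  intro l
  obtain ⟨k, -, hk, -⟩ := exists_sort' (F := F) (fun i : Fin l.length => l.get i)
  have : (l.map (Kel (w1 F))).prod = ∏ i : Fin l.length, Kel (w1 F) (l.get i) := by
    rw [← List.prod_ofFn]
    congr 1
    conv_lhs => rw [← List.ofFn_get l, List.map_ofFn]
    rfl
  rw [this, hk]
  exact h k

lemma lex_le_of_psum {n : ℕ} {m m' : Fin n →₀ ℕ}
    (h : ∀ i : Fin n, ∑ j ∈ Finset.Iic i, m j ≤ ∑ j ∈ Finset.Iic i, m' j) :
    (MonomialOrder.lex (σ := Fin n)).toSyn m ≤ (MonomialOrder.lex (σ := Fin n)).toSyn m' := by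
  by_contra hc
  rw [not_le] at hc
  rw [MonomialOrder.lex_lt_iff] at hc
  obtain ⟨i, h1, h2⟩ := Finsupp.Lex.lt_iff.mp hc
  have h3 := h i
  have : ∀ f : Fin n →₀ ℕ, ∑ j ∈ Finset.Iic i, f j = ∑ j ∈ Finset.Iio i, f j + f i := by
    intro f
    rw [← Finset.Iio_insert, Finset.sum_insert (by simp), add_comm]
  rw [this, this] at h3
  have h4 : ∑ j ∈ Finset.Iio i, m j = ∑ j ∈ Finset.Iio i, m' j := by
    apply Finset.sum_congr rfl
    intro j hj
    exact (h1 j (Finset.mem_Iio.mp hj)).symm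
  have h5 : m' i < m i := h2
  omega

end

section
/-! ### A partial fraction lemma -/

/-- the series `∑_{r ≥ 1} b^r z^r` -/
def geo {K : Type*} [Field K] (b : K) : PowerSeries K :=
  PowerSeries.mk fun r => if r = 0 then 0 else b ^ r

/-- the linear factor `1 - b z` -/
def lin {K : Type*} [Field K] (b : K) : PowerSeries K := 1 - PowerSeries.C b * PowerSeries.X

lemma geo_mul_lin {K : Type*} [Field K] (b : K) :
    geo b * lin b = PowerSeries.C b * PowerSeries.X := by
  have h : geo b * lin b = geo b - PowerSeries.C b * (geo b * PowerSeries.X) := by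
    rw [lin]; ring
  rw [h]
  ext n
  cases n with
  | zero => simp [geo]
  | succ n =>
    rw [map_sub, PowerSeries.coeff_C_mul, PowerSeries.coeff_succ_mul_X, PowerSeries.coeff_C_mul,
      PowerSeries.coeff_X]
    cases n with
    | zero => simp [geo]
    | succ n => simp [geo]; ring

lemma lin_ne_zero {K : Type*} [Field K] (b : K) : lin b ≠ 0 := by
  intro h
  have := congrArg (PowerSeries.constantCoeff) h
  simp [lin] at this

/-- the Euler derivative -/
def eul {K : Type*} [Field K] (f : PowerSeries K) : PowerSeries K :=
  PowerSeries.X * PowerSeries.derivative K f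

lemma eul_mul {K : Type*} [Field K] (f g : PowerSeries K) : eul (f * g) = eul f * g + f * eul g := by
  simp only [eul, Derivation.leibniz, smul_eq_mul]
  ring

lemma eul_lin {K : Type*} [Field K] (b : K) : eul (lin b) = -(geo b * lin b) := by
  rw [geo_mul_lin, eul, lin]
  rw [map_sub, Derivation.leibniz]
  simp
  ring

lemma eul_prod_lin {K : Type*} [Field K] {ι : Type*} (S : Finset ι) (b : ι → K) :
    eul (∏ i ∈ S, lin (b i)) = -((∑ i ∈ S, geo (b i)) * ∏ i ∈ S, lin (b i)) := by
  classical
  induction S using Finset.induction_on with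
  | empty => simp [eul]
  | insert a S ha ih =>
    rw [Finset.prod_insert ha, Finset.sum_insert ha, eul_mul, ih, eul_lin]
    ring

lemma coeff_eul {K : Type*} [Field K] (f : PowerSeries K) (n : ℕ) :
    PowerSeries.coeff n (eul f) = n * PowerSeries.coeff n f := by
  cases n with
  | zero => simp [eul]
  | succ n =>
    rw [eul, PowerSeries.coeff_succ_X_mul, PowerSeries.coeff_derivative]
    push_cast
    ring

lemma rec_unique {K : Type*} [Field K] [CharZero K] {u A B : ℕ → K} (h0 : A 0 = B 0)
    (hA : ∀ r : ℕ, (r : K) * A r = ∑ k ∈ Finset.range r, u k * A (r - 1 - k))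
    (hB : ∀ r : ℕ, (r : K) * B r = ∑ k ∈ Finset.range r, u k * B (r - 1 - k)) (r : ℕ) : A r = B r := by
  induction r using Nat.strong_induction_on with
  | _ r ih =>
    rcases Nat.eq_zero_or_pos r with rfl | hr
    · exact h0
    · have hr' : (r : K) ≠ 0 := by exact_mod_cast hr.ne'
      apply mul_left_cancel₀ hr'
      rw [hA, hB]
      apply Finset.sum_congr rfl
      intro k hk
      rw [Finset.mem_range] at hk
      rw [ih _ (by omega)]

lemma coeff_rec_of_eul {K : Type*} [Field K] {Y U : PowerSeries K}
    (hU : PowerSeries.coeff 0 U = 0) (h : eul Y = U * Y) (r : ℕ) :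
    (r : K) * PowerSeries.coeff r Y =
      ∑ k ∈ Finset.range r, PowerSeries.coeff (k + 1) U * PowerSeries.coeff (r - 1 - k) Y := by
  rw [← coeff_eul, h, PowerSeries.coeff_mul, Finset.Nat.sum_antidiagonal_eq_sum_range_succ_mk,
    Finset.sum_range_succ', hU, zero_mul, add_zero]
  apply Finset.sum_congr rfl
  intro k _
  simp only
  rw [show r - (k + 1) = r - 1 - k by omega]

lemma pf_poly {K : Type*} [Field K] {L : ℕ} (a b ρ : Fin L → K)
    (hb : Function.Injective b) (hb0 : ∀ i, b i ≠ 0) (hρ : ∀ i, b i - a i = ρ i * b i) :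
    (∏ l, (1 - Polynomial.C (b l) * Polynomial.X) : Polynomial K) +
      ∑ i, Polynomial.C (ρ i * ∏ l ∈ Finset.univ.erase i, ((b i - a l) / (b i - b l))) *
        (Polynomial.C (b i) * Polynomial.X) *
        ∏ l ∈ Finset.univ.erase i, (1 - Polynomial.C (b l) * Polynomial.X) =
    ∏ l, (1 - Polynomial.C (a l) * Polynomial.X) := by
  classical
  have hdeg : ∀ (S : Finset (Fin L)) (c : Fin L → K),
      (∏ l ∈ S, (1 - Polynomial.C (c l) * Polynomial.X) : Polynomial K).natDegree ≤ S.card := by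
    intro S c
    refine (Polynomial.natDegree_prod_le _ _).trans ?_
    rw [Finset.card_eq_sum_ones]
    apply Finset.sum_le_sum
    intro l _
    compute_degree
  let pt : Fin (L + 1) → K := Fin.cons 0 (fun i => (b i)⁻¹)
  have hpt : Function.Injective pt := by
    rw [Fin.cons_injective_iff]
    refine ⟨?_, fun i j h => hb (inv_injective h)⟩
    rintro ⟨i, hi⟩
    exact inv_ne_zero (hb0 i) hi
  refine Polynomial.eq_of_degrees_lt_of_eval_index_eq (s := Finset.univ) (v := pt)
    (fun i _ j _ h => hpt h) ?_ ?_ ?_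
  · rw [Finset.card_univ, Fintype.card_fin]
    refine lt_of_le_of_lt Polynomial.degree_le_natDegree (Nat.cast_lt.mpr ?_)
    refine Nat.lt_succ_of_le ?_
    refine (Polynomial.natDegree_add_le _ _).trans (max_le ?_ ?_)
    · simpa using hdeg Finset.univ b
    · refine (Polynomial.natDegree_sum_le_of_forall_le _ _ ?_)
      intro i _
      have h1 := hdeg (Finset.univ.erase i) b
      rw [Finset.card_erase_of_mem (Finset.mem_univ i), Finset.card_univ, Fintype.card_fin] at h1
      have hL : 0 < L := i.pos
      refine (Polynomial.natDegree_mul_le).trans ?_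
      have h2 : (Polynomial.C (ρ i * ∏ l ∈ Finset.univ.erase i, ((b i - a l) / (b i - b l))) *
        (Polynomial.C (b i) * Polynomial.X)).natDegree ≤ 1 := by compute_degree
      omega
  · rw [Finset.card_univ, Fintype.card_fin]
    refine lt_of_le_of_lt Polynomial.degree_le_natDegree (Nat.cast_lt.mpr ?_)
    have := hdeg Finset.univ a
    rw [Finset.card_univ, Fintype.card_fin] at this
    omega
  · intro j _
    refine Fin.cases ?_ (fun j => ?_) j
    · simp [pt, Polynomial.eval_prod, Polynomial.eval_finsetSum]
    · simp only [pt, Fin.cons_succ]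
      simp only [Polynomial.eval_add, Polynomial.eval_prod, Polynomial.eval_finsetSum,
        Polynomial.eval_mul, Polynomial.eval_sub, Polynomial.eval_one, Polynomial.eval_C,
        Polynomial.eval_X]
      rw [Finset.prod_eq_zero (Finset.mem_univ j) (by rw [mul_inv_cancel₀ (hb0 j), sub_self]),
        zero_add, Finset.sum_eq_single j]
      · rw [mul_inv_cancel₀ (hb0 j), mul_one, mul_assoc, ← Finset.prod_mul_distrib,
          ← Finset.mul_prod_erase _ _ (Finset.mem_univ j)]
        congr 1
        · have := hρ j
          field_simp [hb0 j]
          linear_combination -this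
        · apply Finset.prod_congr rfl
          intro l hl
          have hne : b j - b l ≠ 0 := by
            rw [sub_ne_zero]
            exact fun h => (Finset.mem_erase.mp hl).1 (hb h).symm
          have := hb0 j
          field_simp
      · intro i _ hi
        refine mul_eq_zero_of_right _ (Finset.prod_eq_zero (i := j)
          (Finset.mem_erase.mpr ⟨Ne.symm hi, Finset.mem_univ _⟩) ?_)
        rw [mul_inv_cancel₀ (hb0 j), sub_self]
      · simp

lemma pf_lemma {K : Type*} [Field K] [CharZero K] {L : ℕ} (a b ρ : Fin L → K)
    (hb : Function.Injective b) (hb0 : ∀ i, b i ≠ 0) (hρ : ∀ i, b i - a i = ρ i * b i)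
    (A : ℕ → K) (h0 : A 0 = 1)
    (hA : ∀ r : ℕ, (r : K) * A r =
      ∑ k ∈ Finset.range r, (∑ i, (b i ^ (k + 1) - a i ^ (k + 1))) * A (r - 1 - k)) (r : ℕ) :
    A (r + 1) = ∑ i, (ρ i * ∏ l ∈ Finset.univ.erase i, ((b i - a l) / (b i - b l))) *
      b i ^ (r + 1) := by
  classical
  let c : Fin L → K := fun i => ρ i * ∏ l ∈ Finset.univ.erase i, ((b i - a l) / (b i - b l))
  let Y : PowerSeries K := 1 + ∑ i, PowerSeries.C (c i) * geo (b i)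
  have hY : Y * ∏ l, lin (b l) = ∏ l, lin (a l) := by
    have h := congrArg (Polynomial.coeToPowerSeries.ringHom (R := K)) (pf_poly a b ρ hb hb0 hρ)
    simp only [map_add, map_sum, map_prod, map_sub, map_one, map_mul (Polynomial.coeToPowerSeries.ringHom (R := K)),
      Polynomial.coeToPowerSeries.ringHom_apply, Polynomial.coe_C, Polynomial.coe_X] at h
    simp only [lin]
    rw [← h]
    simp only [Y, add_mul, one_mul, Finset.sum_mul]
    congr 1
    apply Finset.sum_congr rfl
    intro i _
    rw [← Finset.mul_prod_erase _ _ (Finset.mem_univ i)]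
    have := geo_mul_lin (b i)
    rw [lin] at this
    simp only [c]
    linear_combination (PowerSeries.C (ρ i * ∏ l ∈ Finset.univ.erase i,
      ((b i - a l) / (b i - b l))) * ∏ x ∈ Finset.univ.erase i,
        (1 - PowerSeries.C (b x) * PowerSeries.X)) * this
  have hG : (∏ l, lin (b l)) ≠ 0 := Finset.prod_ne_zero_iff.mpr fun l _ => lin_ne_zero _
  let U : PowerSeries K := ∑ i, geo (b i) - ∑ i, geo (a i)
  have hE : eul Y = U * Y := by
    have h1 := congrArg eul hY
    rw [eul_mul, eul_prod_lin, eul_prod_lin, ← hY] at h1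
    apply mul_right_cancel₀ hG
    simp only [U]
    linear_combination h1
  have hrec := coeff_rec_of_eul (Y := Y) (U := U) (by simp [U, geo]) hE
  have hU : ∀ k, PowerSeries.coeff (k + 1) U = ∑ i, (b i ^ (k + 1) - a i ^ (k + 1)) := by
    intro k
    simp [U, geo, Finset.sum_sub_distrib]
  have := rec_unique (u := fun k => ∑ i, (b i ^ (k + 1) - a i ^ (k + 1)))
    (A := A) (B := fun r => PowerSeries.coeff r Y) (by simp [Y, h0, geo]) hA
    (by intro r; rw [hrec]; simp only [hU]) (r + 1)
  rw [this]
  simp only [Y, geo, map_add, map_sum, PowerSeries.coeff_C_mul, PowerSeries.coeff_one,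
    PowerSeries.coeff_mk, c]
  simp

end

section
/-! ### Leading monomials -/

/-- `f` has degree at most `m` for the lexicographic order and coefficient `c` at `m` -/
def Ld {L : ℕ} (f : MvPolynomial (Fin L) F) (m : Fin L →₀ ℕ) (c : F) : Prop :=
  (MonomialOrder.lex (σ := Fin L)).toSyn ((MonomialOrder.lex (σ := Fin L)).degree f) ≤
    (MonomialOrder.lex (σ := Fin L)).toSyn m ∧ f.coeff m = c

lemma Ld.mul {L : ℕ} {f g : MvPolynomial (Fin L) F} {m n : Fin L →₀ ℕ} {c d : F}
    (hf : Ld f m c) (hg : Ld g n d) : Ld (f * g) (m + n) (c * d) := by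
  refine ⟨MonomialOrder.degree_mul_le.trans ?_, ?_⟩
  · rw [map_add, map_add]
    exact add_le_add hf.1 hg.1
  · rw [MonomialOrder.coeff_mul_of_add_of_degree_le hf.1 hg.1, hf.2, hg.2]

lemma Ld.add {L : ℕ} {f g : MvPolynomial (Fin L) F} {m : Fin L →₀ ℕ} {c d : F}
    (hf : Ld f m c) (hg : Ld g m d) : Ld (f + g) m (c + d) :=
  ⟨MonomialOrder.degree_add_le.trans (max_le hf.1 hg.1), by rw [MvPolynomial.coeff_add, hf.2, hg.2]⟩

lemma Ld.sub {L : ℕ} {f g : MvPolynomial (Fin L) F} {m : Fin L →₀ ℕ} {c d : F}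
    (hf : Ld f m c) (hg : Ld g m d) : Ld (f - g) m (c - d) :=
  ⟨MonomialOrder.degree_sub_le.trans (max_le hf.1 hg.1), by rw [MvPolynomial.coeff_sub, hf.2, hg.2]⟩

lemma Ld.smul {L : ℕ} {f : MvPolynomial (Fin L) F} {m : Fin L →₀ ℕ} {c : F}
    (hf : Ld f m c) (a : F) : Ld (a • f) m (a * c) :=
  ⟨MonomialOrder.degree_smul_le.trans hf.1, by rw [MvPolynomial.coeff_smul, hf.2, smul_eq_mul]⟩

lemma Ld.zero {L : ℕ} (m : Fin L →₀ ℕ) : Ld (0 : MvPolynomial (Fin L) F) m 0 :=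
  ⟨by rw [MonomialOrder.degree_zero, map_zero]; exact MonomialOrder.zero_le _ _,
    by simp⟩

lemma Ld.sum {L : ℕ} {ι : Type*} (S : Finset ι) {f : ι → MvPolynomial (Fin L) F} {m : Fin L →₀ ℕ}
    {c : ι → F} (h : ∀ i ∈ S, Ld (f i) m (c i)) : Ld (∑ i ∈ S, f i) m (∑ i ∈ S, c i) := by
  classical
  induction S using Finset.induction_on with
  | empty => simpa using Ld.zero m
  | insert a S ha ih =>
    rw [Finset.sum_insert ha, Finset.sum_insert ha]
    exact (h a (Finset.mem_insert_self _ _)).add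
      (ih fun i hi => h i (Finset.mem_insert_of_mem hi))

lemma Ld.one {L : ℕ} : Ld (1 : MvPolynomial (Fin L) F) 0 1 :=
  ⟨by simp, by simp⟩

lemma Ld.C {L : ℕ} (a : F) : Ld (MvPolynomial.C a : MvPolynomial (Fin L) F) 0 a :=
  ⟨by simp, by simp⟩

lemma Ld.prod {L : ℕ} {ι : Type*} (S : Finset ι) {f : ι → MvPolynomial (Fin L) F}
    {m : ι → Fin L →₀ ℕ}
    {c : ι → F} (h : ∀ i ∈ S, Ld (f i) (m i) (c i)) :
    Ld (∏ i ∈ S, f i) (∑ i ∈ S, m i) (∏ i ∈ S, c i) := by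
  classical
  induction S using Finset.induction_on with
  | empty => simpa using Ld.one
  | insert a S ha ih =>
    rw [Finset.sum_insert ha, Finset.prod_insert ha, Finset.prod_insert ha]
    exact (h a (Finset.mem_insert_self _ _)).mul
      (ih fun i hi => h i (Finset.mem_insert_of_mem hi))

lemma Ld.degree_eq {L : ℕ} {f : MvPolynomial (Fin L) F} {m : Fin L →₀ ℕ} {c : F}
    (hf : Ld f m c) (hc : c ≠ 0) : (MonomialOrder.lex (σ := Fin L)).degree f = m := by
  apply (MonomialOrder.lex (σ := Fin L)).toSyn.injective
  apply le_antisymm hf.1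
  apply MonomialOrder.le_degree
  rw [MvPolynomial.mem_support_iff, hf.2]
  exact hc

lemma Ld.cancel {L : ℕ} {f g : MvPolynomial (Fin L) F} {m n : Fin L →₀ ℕ} {c d : F}
    (hf : Ld f m c) (hc : c ≠ 0) (hfg : Ld (f * g) (m + n) (c * d)) : Ld g n d := by
  by_cases hg : g = 0
  · subst hg
    have := hfg.2
    simp only [mul_zero, MvPolynomial.coeff_zero] at this
    rw [(mul_eq_zero.mp this.symm).resolve_left hc]
    exact Ld.zero n
  have hf0 : f ≠ 0 := by
    rintro rfl
    exact hc (by simpa using hf.2.symm)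
  have h1 := hfg.1
  rw [MonomialOrder.degree_mul hf0 hg, hf.degree_eq hc, map_add, map_add] at h1
  have h2 : (MonomialOrder.lex (σ := Fin L)).toSyn ((MonomialOrder.lex (σ := Fin L)).degree g) ≤
    (MonomialOrder.lex (σ := Fin L)).toSyn n := le_of_add_le_add_left h1
  refine ⟨h2, ?_⟩
  have h3 := MonomialOrder.coeff_mul_of_add_of_degree_le hf.1 h2
  rw [hfg.2, hf.2] at h3
  exact (mul_left_cancel₀ hc h3).symm

lemma Ld.of_degree {L : ℕ} (f : MvPolynomial (Fin L) F) :
    Ld f ((MonomialOrder.lex (σ := Fin L)).degree f)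
      (f.coeff ((MonomialOrder.lex (σ := Fin L)).degree f)) := ⟨le_rfl, rfl⟩

/-- rescaling one variable -/
def tau {L : ℕ} (i : Fin L) (c : F) : MvPolynomial (Fin L) F →ₐ[F] MvPolynomial (Fin L) F :=
  MvPolynomial.aeval fun l => MvPolynomial.C (if l = i then c else 1) * MvPolynomial.X l

lemma tau_monomial {L : ℕ} (i : Fin L) (c : F) (e : Fin L →₀ ℕ) (a : F) :
    tau i c (MvPolynomial.monomial e a) = MvPolynomial.monomial e (c ^ (e i) * a) := by
  rw [tau, MvPolynomial.aeval_monomial]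
  rw [Finsupp.prod_fintype _ _ (by simp)]
  simp only [mul_pow]
  rw [Finset.prod_mul_distrib]
  have h1 : ∏ l, (MvPolynomial.C (if l = i then c else 1) : MvPolynomial (Fin L) F) ^ e l =
      MvPolynomial.C (c ^ e i) := by
    rw [Finset.prod_eq_single i]
    · simp
    · intro l _ hl; simp [hl]
    · simp
  rw [h1, MvPolynomial.monomial_eq, Finsupp.prod_fintype _ _ (by simp),
    MvPolynomial.algebraMap_eq, MvPolynomial.C_mul]
  ring

lemma coeff_tau {L : ℕ} (i : Fin L) (c : F) (e : Fin L →₀ ℕ) (f : MvPolynomial (Fin L) F) :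
    (tau i c f).coeff e = c ^ (e i) * f.coeff e := by
  classical
  induction f using MvPolynomial.induction_on' with
  | monomial d a =>
    rw [tau_monomial, MvPolynomial.coeff_monomial, MvPolynomial.coeff_monomial]
    by_cases h : d = e
    · simp [h]
    · simp [h]
  | add p q hp hq => rw [map_add, MvPolynomial.coeff_add, MvPolynomial.coeff_add, hp, hq, mul_add]

lemma Ld.tau {L : ℕ} {f : MvPolynomial (Fin L) F} {m : Fin L →₀ ℕ} {c : F}
    (hf : Ld f m c) (i : Fin L) (a : F) : Ld (tau i a f) m (a ^ m i * c) := by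
  refine ⟨?_, by rw [coeff_tau, hf.2]⟩
  rw [MonomialOrder.degree_le_iff]
  intro e he
  rw [MvPolynomial.mem_support_iff, coeff_tau] at he
  exact MonomialOrder.degree_le_iff.mp hf.1 e
    (MvPolynomial.mem_support_iff.mpr (right_ne_zero_of_mul he))

/-! ### The Macdonald operator -/

/-- The Macdonald operator -/
def Dop (q s : F) : Sym F →ₗ[F] Sym F :=
  (Polynomial.lsum (fun r => LinearMap.mulLeft F (Kel (fun k => 1 - s ^ (k + 1)) r))).comp
    (psi fun k => -(1 - q ^ (k + 1))).toLinearMap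

lemma Dop_apply (q s : F) (f : Sym F) {N : ℕ}
    (hN : (psi (fun k => -(1 - q ^ (k + 1))) f).natDegree < N) :
    Dop q s f = ∑ r ∈ Finset.range N,
      Kel (fun k => 1 - s ^ (k + 1)) r * Sop (fun k => -(1 - q ^ (k + 1))) r f := by
  rw [Dop, LinearMap.comp_apply, Polynomial.lsum_apply, AlgHom.toLinearMap_apply,
    Polynomial.sum_over_range' _ (by simp) N hN]
  rfl

lemma phi_C {L : ℕ} (θ : Fin L → ℕ → F) (a : F) : phi θ (MvPolynomial.C a) = MvPolynomial.C a := by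
  rw [← MvPolynomial.algebraMap_eq, AlgHom.commutes, MvPolynomial.algebraMap_eq]

lemma tau_C {L : ℕ} (i : Fin L) (c a : F) : tau i c (MvPolynomial.C a) = MvPolynomial.C a := by
  rw [← MvPolynomial.algebraMap_eq, AlgHom.commutes]

/-- Compatibility of the parameters of a finite evaluation. -/
structure Par (q s : F) {L : ℕ} (θ : Fin L → ℕ → F) (α β γ : Fin L → F) : Prop where
  h1 : ∀ i k, θ i k * (γ i ^ (k + 1) - 1) = -(1 - q ^ (k + 1)) * β i ^ (k + 1)
  h2 : ∀ i k, (1 - s ^ (k + 1)) * θ i k = β i ^ (k + 1) - α i ^ (k + 1)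
  hβ : ∀ i, β i ≠ 0

section
variable {q s : F} {L : ℕ} {θ : Fin L → ℕ → F} {α β γ : Fin L → F}

/-- the difference `b_i - b_l` or `b_i - a_l` -/
def dif (c : F) (i : Fin L) (d : F) (l : Fin L) : MvPolynomial (Fin L) F :=
  MvPolynomial.C c * MvPolynomial.X i - MvPolynomial.C d * MvPolynomial.X l

/-- products of differences -/
def Dpr (β : Fin L → F) (i : Fin L) : MvPolynomial (Fin L) F :=
  ∏ l ∈ Finset.univ.erase i, dif (β i) i (β l) l

/-- the coefficients -/
def Cpr (α β : Fin L → F) (i : Fin L) : MvPolynomial (Fin L) F :=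
  MvPolynomial.C (1 - α i / β i) * (∏ l ∈ Finset.univ.erase i, dif (β i) i (α l) l) *
    ∏ j ∈ Finset.univ.erase i, Dpr β j

lemma dif_ne {i l : Fin L} (h : i ≠ l) {c d : F} (hc : c ≠ 0) : dif c i d l ≠ 0 := by
  intro h0
  have := congrArg (MvPolynomial.coeff (Finsupp.single i 1)) h0
  rw [dif, MvPolynomial.coeff_sub, MvPolynomial.coeff_C_mul, MvPolynomial.coeff_C_mul,
    MvPolynomial.coeff_X, MvPolynomial.coeff_X, if_pos rfl, if_neg] at this
  · simp at this; exact hc this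
  · intro h2
    exact h (Finsupp.single_left_injective one_ne_zero h2).symm

lemma frac_aux {K : Type*} [Field K] (x y z u : K) (hx : x ≠ 0) :
    x * z * (u * (y / x)) = u * y * z := by
  field_simp

lemma pf_phi [CharZero F] (hp : Par q s θ α β γ) (r : ℕ) :
    (∏ i, Dpr β i) * phi θ (Kel (fun k => 1 - s ^ (k + 1)) (r + 1)) =
      ∑ i, Cpr α β i * (MvPolynomial.C (β i) * MvPolynomial.X i) ^ (r + 1) := by
  classical
  let R := MvPolynomial (Fin L) F
  let K := FractionRing R
  let ι : R →+* K := algebraMap R K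
  have hι : Function.Injective ι := IsFractionRing.injective R K
  have : CharZero K := charZero_of_injective_algebraMap hι
  let b : Fin L → K := fun i => ι (MvPolynomial.C (β i) * MvPolynomial.X i)
  let a : Fin L → K := fun i => ι (MvPolynomial.C (α i) * MvPolynomial.X i)
  let ρ : Fin L → K := fun i => ι (MvPolynomial.C (1 - α i / β i))
  have hbne : ∀ i l, i ≠ l → b i - b l ≠ 0 := by
    intro i l hil
    simp only [b]
    rw [← map_sub]
    exact (map_ne_zero_iff ι hι).mpr (dif_ne hil (hp.hβ i))
  have hA := pf_lemma a b ρ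
    (fun i l h => by
      by_contra hil
      exact hbne i l hil (sub_eq_zero.mpr h))
    (fun i => (map_ne_zero_iff ι hι).mpr (mul_ne_zero
      ((map_ne_zero_iff _ (MvPolynomial.C_injective _ _)).mpr (hp.hβ i)) (MvPolynomial.X_ne_zero i)))
    (fun i => by
      simp only [a, b, ρ]
      rw [← map_sub, ← map_mul, ← mul_assoc, ← MvPolynomial.C_mul, ← sub_mul, ← MvPolynomial.C_sub]
      congr 3
      field_simp [hp.hβ i])
    (fun r => ι (phi θ (Kel (fun k => 1 - s ^ (k + 1)) r)))
    (by simp [Kel_zero])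
    (by
      intro r
      have h := congrArg (fun f => ι (phi θ f)) (Kel_rec (fun k => 1 - s ^ (k + 1)) r)
      simp only [map_sum, map_smul, map_mul, MvPolynomial.smul_eq_C_mul, map_natCast] at h
      rw [h]
      apply Finset.sum_congr rfl
      intro k _
      rw [← mul_assoc]
      congr 1
      rw [phi_X, phi_C, ← map_mul, Finset.mul_sum, map_sum]
      apply Finset.sum_congr rfl
      intro i _
      simp only [a, b]
      rw [← map_pow, ← map_pow, ← map_sub]
      congr 1
      rw [← mul_assoc, ← MvPolynomial.C_mul, hp.h2 i k, MvPolynomial.C_sub, mul_pow, mul_pow,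
        MvPolynomial.C_pow, MvPolynomial.C_pow]
      ring) r
  apply hι
  rw [map_mul, hA, map_sum, Finset.mul_sum]
  apply Finset.sum_congr rfl
  intro i _
  rw [map_mul ι (Cpr α β i), map_pow, ← mul_assoc]
  congr 1
  have hD : (∏ i, Dpr β i) = Dpr β i * ∏ j ∈ Finset.univ.erase i, Dpr β j :=
    (Finset.mul_prod_erase _ _ (Finset.mem_univ i)).symm
  rw [hD, Cpr, map_mul, map_mul, map_mul, Dpr, map_prod, map_prod ι (fun l => dif (β i) i (α l) l)]
  have hdiv : ∏ l ∈ Finset.univ.erase i, ((b i - a l) / (b i - b l)) =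
    (∏ l ∈ Finset.univ.erase i, (b i - a l)) / ∏ l ∈ Finset.univ.erase i, (b i - b l) :=
      Finset.prod_div_distrib _ _
  have e1 : ∏ l ∈ Finset.univ.erase i, ι (dif (β i) i (β l) l) =
      ∏ l ∈ Finset.univ.erase i, (b i - b l) := by
    simp only [dif, b, map_sub]
  have e2 : ∏ l ∈ Finset.univ.erase i, ι (dif (β i) i (α l) l) =
      ∏ l ∈ Finset.univ.erase i, (b i - a l) := by
    simp only [dif, b, a, map_sub]
  have hne : ∏ l ∈ Finset.univ.erase i, (b i - b l) ≠ 0 :=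
    Finset.prod_ne_zero_iff.mpr fun l hl => hbne i l (Finset.ne_of_mem_erase hl).symm
  rw [hdiv, e1, e2]
  exact frac_aux _ _ _ _ hne

lemma sum_Sop_phi (hp : Par q s θ α β γ) (i : Fin L) (f : Sym F) {N : ℕ}
    (hN : (psi (fun k => -(1 - q ^ (k + 1))) f).natDegree < N) :
    ∑ r ∈ Finset.range N, (MvPolynomial.C (β i) * MvPolynomial.X i) ^ r *
      phi θ (Sop (fun k => -(1 - q ^ (k + 1))) r f) = tau i (γ i) (phi θ f) := by
  classical
  let E : Polynomial (Sym F) →+* MvPolynomial (Fin L) F :=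
    Polynomial.eval₂RingHom (phi θ).toRingHom (MvPolynomial.C (β i) * MvPolynomial.X i)
  have h1 : E.comp (psi (fun k => -(1 - q ^ (k + 1)))).toRingHom =
      ((tau i (γ i)).comp (phi θ)).toRingHom := by
    apply MvPolynomial.ringHom_ext
    · intro c
      simp [E]
    · intro k
      simp only [RingHom.comp_apply, AlgHom.toRingHom_eq_coe, RingHom.coe_coe, psi_X, E,
        Polynomial.coe_eval₂RingHom, Polynomial.eval₂_add, Polynomial.eval₂_mul, Polynomial.eval₂_C,
        Polynomial.eval₂_pow, Polynomial.eval₂_X, AlgHom.comp_apply, phi_X, map_sum, map_mul,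
        map_pow, tau_C]
      symm
      rw [← sub_eq_iff_eq_add']
      rw [← Finset.sum_sub_distrib, Finset.sum_eq_single i]
      · simp only [tau, MvPolynomial.aeval_X, if_true]
        rw [phi_C]
        simp only [mul_pow]
        rw [← mul_assoc (MvPolynomial.C (-(1 - q ^ (k + 1)))), ← MvPolynomial.C_pow,
          ← MvPolynomial.C_pow, ← MvPolynomial.C_mul, ← hp.h1 i k, MvPolynomial.C_mul,
          MvPolynomial.C_sub, MvPolynomial.C_1]
        ring
      · intro l _ hl
        simp [tau, hl]
      · simp
  have h2 := congrArg (fun l => l f) h1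
  have h3 : E (psi (fun k => -(1 - q ^ (k + 1))) f) = tau i (γ i) (phi θ f) := h2
  rw [← h3]
  simp only [E, Polynomial.coe_eval₂RingHom]
  rw [Polynomial.eval₂_eq_sum_range' _ hN]
  apply Finset.sum_congr rfl
  intro r _
  rw [mul_comm]
  rfl

lemma phi_Dop [CharZero F] (hp : Par q s θ α β γ) (f : Sym F) :
    (∏ i, Dpr β i) * phi θ (Dop q s f) = (∏ i, Dpr β i) * phi θ f +
      ∑ i, Cpr α β i * (tau i (γ i) (phi θ f) - phi θ f) := by
  obtain ⟨N, hN⟩ : ∃ N, (psi (fun k => -(1 - q ^ (k + 1))) f).natDegree < N + 1 :=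
    ⟨_, Nat.lt_succ_self _⟩
  rw [Dop_apply q s f hN, Finset.sum_range_succ', Kel_zero, Sop_zero, one_mul, map_add, mul_add,
    add_comm]
  congr 1
  have h2 : ∀ i, tau i (γ i) (phi θ f) - phi θ f = ∑ r ∈ Finset.range N,
      (MvPolynomial.C (β i) * MvPolynomial.X i) ^ (r + 1) *
      phi θ (Sop (fun k => -(1 - q ^ (k + 1))) (r + 1) f) := by
    intro i
    rw [← sum_Sop_phi hp i f hN, Finset.sum_range_succ', Sop_zero]
    ring
  simp only [h2, map_sum, map_mul, Finset.mul_sum]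
  rw [Finset.sum_comm]
  apply Finset.sum_congr rfl
  intro r _
  rw [← mul_assoc, pf_phi hp r, Finset.sum_mul]
  apply Finset.sum_congr rfl
  intro i _
  ring

end

end

section
section
variable {q s : F} {L : ℕ} {θ : Fin L → ℕ → F} {α β γ : Fin L → F}

lemma Ld_X {i j : Fin L} (h : j ≤ i) :
    Ld (MvPolynomial.X i : MvPolynomial (Fin L) F) (Finsupp.single j 1) (if i = j then 1 else 0) := by
  classical
  refine ⟨MonomialOrder.degree_X_le_single.trans ?_, ?_⟩
  · rw [MonomialOrder.lex_le_iff, Finsupp.Lex.single_le_iff]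
    exact h
  · rw [MvPolynomial.coeff_X]
    simp [Finsupp.single_left_inj]

lemma Ld_CX {i j : Fin L} (h : j ≤ i) (c : F) :
    Ld (MvPolynomial.C c * MvPolynomial.X i : MvPolynomial (Fin L) F) (Finsupp.single j 1)
      (if i = j then c else 0) := by
  have := (Ld_X (F := F) h).smul c
  rw [MvPolynomial.smul_eq_C_mul] at this
  simpa using this

lemma Ld_dif {i l : Fin L} (h : i ≠ l) (c d : F) :
    Ld (dif c i d l) (Finsupp.single (min i l) 1) (if i < l then c else -d) := by
  have := (Ld_CX (min_le_left i l) c).sub (Ld_CX (min_le_right i l) d)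
  rw [dif]
  convert this using 1
  rcases lt_or_gt_of_ne h with h1 | h1
  · simp [h1, min_eq_left h1.le, h.symm]
  · simp [h1, min_eq_right h1.le, h, not_lt_of_gt h1]

/-- exponent of the leading term of `Dpr` -/
def dexp (i : Fin L) : Fin L →₀ ℕ := ∑ l ∈ Finset.univ.erase i, Finsupp.single (min i l) 1

/-- its leading coefficient -/
def dlc (β : Fin L → F) (i : Fin L) : F := ∏ l ∈ Finset.univ.erase i, if i < l then β i else -β l

lemma Ld_Dpr (β : Fin L → F) (i : Fin L) : Ld (Dpr β i) (dexp i) (dlc β i) :=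
  Ld.prod _ fun l hl => Ld_dif (Finset.ne_of_mem_erase hl).symm _ _

lemma dlc_ne_zero (hβ : ∀ i, β i ≠ 0) (i : Fin L) : dlc β i ≠ 0 := by
  rw [dlc, Finset.prod_ne_zero_iff]
  intro l _
  split_ifs
  · exact hβ i
  · exact neg_ne_zero.mpr (hβ l)

lemma Ld_Cpr (hβ : ∀ i, β i ≠ 0) (i : Fin L) : Ld (Cpr α β i) (∑ j, dexp j)
    ((1 - α i / β i) * (∏ l ∈ Finset.Iio i, α l / β l) * ∏ j, dlc β j) := by
  have h1 : Ld (∏ l ∈ Finset.univ.erase i, dif (β i) i (α l) l) (dexp i)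
      (∏ l ∈ Finset.univ.erase i, if i < l then β i else -α l) :=
    Ld.prod _ fun l hl => Ld_dif (Finset.ne_of_mem_erase hl).symm _ _
  have h2 : Ld (∏ j ∈ Finset.univ.erase i, Dpr β j) (∑ j ∈ Finset.univ.erase i, dexp j)
      (∏ j ∈ Finset.univ.erase i, dlc β j) := Ld.prod _ fun l _ => Ld_Dpr β l
  have h3 := ((Ld.C (1 - α i / β i)).mul h1).mul h2
  rw [Cpr]
  convert h3 using 1
  · rw [zero_add, Finset.add_sum_erase _ _ (Finset.mem_univ i)]
  · rw [← Finset.mul_prod_erase _ (dlc β) (Finset.mem_univ i), ← mul_assoc]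
    congr 1
    rw [mul_assoc]
    congr 1
    have h4 : ∏ l ∈ Finset.Iio i, α l / β l =
        ∏ l ∈ Finset.univ.erase i, if i < l then 1 else α l / β l := by
      rw [← Finset.prod_subset (s₁ := Finset.Iio i) (s₂ := Finset.univ.erase i)]
      · apply Finset.prod_congr rfl
        intro l hl
        rw [if_neg (not_lt_of_gt (Finset.mem_Iio.mp hl))]
      · intro l hl
        exact Finset.mem_erase.mpr ⟨(Finset.mem_Iio.mp hl).ne, Finset.mem_univ _⟩
      · intro l hl hl2
        rw [Finset.mem_Iio] at hl2
        rw [if_pos]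
        exact lt_of_le_of_ne (not_lt.mp hl2) (Finset.ne_of_mem_erase hl).symm
    rw [h4, dlc, ← Finset.prod_mul_distrib]
    apply Finset.prod_congr rfl
    intro l _
    split_ifs
    · simp
    · have := hβ l
      field_simp

/-- the eigenvalue attached to a leading exponent -/
def Eig (α β γ : Fin L → F) (m : Fin L →₀ ℕ) : F :=
  1 + ∑ i, (1 - α i / β i) * (∏ l ∈ Finset.Iio i, α l / β l) * (γ i ^ m i - 1)

lemma Dpr_prod_ne (hβ : ∀ i, β i ≠ 0) : (∏ i, Dpr β i) ≠ 0 := by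
  rw [Finset.prod_ne_zero_iff]
  intro i _
  rw [Dpr, Finset.prod_ne_zero_iff]
  intro l hl
  exact dif_ne (Finset.ne_of_mem_erase hl).symm (hβ i)

lemma Ld_Dop [CharZero F] (hp : Par q s θ α β γ) {f : Sym F} {m : Fin L →₀ ℕ} {c : F}
    (h : Ld (phi θ f) m c) : Ld (phi θ (Dop q s f)) m (Eig α β γ m * c) := by
  have hD : Ld (∏ i, Dpr β i) (∑ j, dexp j) (∏ j, dlc β j) := Ld.prod _ fun l _ => Ld_Dpr β l
  apply hD.cancel (Finset.prod_ne_zero_iff.mpr fun i _ => dlc_ne_zero hp.hβ i)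
  rw [phi_Dop hp]
  have := (hD.mul h).add (Ld.sum Finset.univ fun i _ =>
    (Ld_Cpr (α := α) hp.hβ i).mul ((h.tau i (γ i)).sub h))
  convert this using 1
  rw [Eig, add_mul, mul_add, one_mul]
  congr 1
  rw [Finset.sum_mul, Finset.mul_sum]
  apply Finset.sum_congr rfl
  intro i _
  ring

lemma phi_Dop_zero [CharZero F] (hp : Par q s θ α β γ) {f : Sym F}
    (h : phi θ f = 0) : phi θ (Dop q s f) = 0 := by
  have := phi_Dop hp f
  rw [h] at this
  simp only [mul_zero, map_zero, sub_self, Finset.sum_const_zero, add_zero] at this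
  exact (mul_eq_zero.mp this).resolve_left (Dpr_prod_ne hp.hβ)

end

/-! ### supersymmetric evaluations -/

/-- the weights of the `(q,t)` pairing -/
def wqt (q t : F) : ℕ → F := fun n => (1 - q ^ (n + 1)) / (1 - t ^ (n + 1))

/-- the weights of the supersymmetric evaluation -/
def thXY (q t : F) (N M : ℕ) : Fin (N + M) → ℕ → F :=
  Fin.addCases (fun _ _ => 1) (fun _ k => -wqt q t k)

/-- parameter -/
def alXY (q t : F) (N M : ℕ) : Fin (N + M) → F := Fin.addCases (fun _ => t⁻¹) (fun _ => q * t⁻¹)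

/-- parameter -/
def beXY (_q t : F) (N M : ℕ) : Fin (N + M) → F := Fin.addCases (fun _ => 1) (fun _ => t⁻¹)

/-- parameter -/
def gaXY (q t : F) (N M : ℕ) : Fin (N + M) → F := Fin.addCases (fun _ => q) (fun _ => t⁻¹)

lemma parXY {q t : F} (ht0 : t ≠ 0) (ht : ∀ k : ℕ, 1 - t ^ (k + 1) ≠ 0) (N M : ℕ) :
    Par q t⁻¹ (thXY q t N M) (alXY q t N M) (beXY q t N M) (gaXY q t N M) := by
  refine ⟨?_, ?_, ?_⟩
  · intro i k
    refine Fin.addCases (fun i => ?_) (fun i => ?_) i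
    · simp [thXY, gaXY, beXY]
    · simp only [thXY, gaXY, beXY, Fin.addCases_right, wqt, inv_pow, mul_pow]
      have := ht k
      have h0 : t ^ (k + 1) ≠ 0 := pow_ne_zero _ ht0
      generalize t ^ (k + 1) = T at *
      field_simp
      try ring
  · intro i k
    refine Fin.addCases (fun i => ?_) (fun i => ?_) i
    · simp [thXY, alXY, beXY]
    · simp only [thXY, alXY, beXY, Fin.addCases_right, wqt, inv_pow, mul_pow]
      have := ht k
      have h0 : t ^ (k + 1) ≠ 0 := pow_ne_zero _ ht0
      generalize t ^ (k + 1) = T at *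
      field_simp
      try ring
  · intro i
    refine Fin.addCases (fun i => ?_) (fun i => ?_) i
    · simp [beXY]
    · simp [beXY, ht0]

/-- the boxes attached to an exponent -/
def boxM (N M : ℕ) (m : Fin (N + M) →₀ ℕ) : Finset (ℕ × ℕ) :=
  (Finset.univ : Finset (Fin N)).biUnion (fun i =>
      (Finset.range (m (Fin.castAdd M i))).image fun j => ((i : ℕ), j)) ∪
    (Finset.univ : Finset (Fin M)).biUnion (fun j =>
      (Finset.range (m (Fin.natAdd N j))).image fun i => (N + i, (j : ℕ)))

/-- the eigenvalue attached to a set of boxes -/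
def eig (q t : F) (S : Finset (ℕ × ℕ)) : F :=
  1 - (1 - t⁻¹) * (1 - q) * ∑ p ∈ S, t⁻¹ ^ p.1 * q ^ p.2

lemma mem_boxM {N M : ℕ} {m : Fin (N + M) →₀ ℕ} {p : ℕ × ℕ} : p ∈ boxM N M m ↔
    (∃ i : Fin N, p.1 = i ∧ p.2 < m (Fin.castAdd M i)) ∨
    (∃ j : Fin M, p.2 = j ∧ ∃ a, a < m (Fin.natAdd N j) ∧ p.1 = N + a) := by
  obtain ⟨x, y⟩ := p
  simp only [boxM, Finset.mem_union, Finset.mem_biUnion, Finset.mem_univ, true_and,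
    Finset.mem_image, Finset.mem_range, Prod.mk.injEq]
  constructor
  · rintro (⟨i, a, h, rfl, rfl⟩ | ⟨j, a, h, rfl, rfl⟩)
    · exact Or.inl ⟨i, rfl, h⟩
    · exact Or.inr ⟨j, rfl, a, h, rfl⟩
  · rintro (⟨i, rfl, h⟩ | ⟨j, rfl, a, h, rfl⟩)
    · exact Or.inl ⟨i, y, h, rfl, rfl⟩
    · exact Or.inr ⟨j, a, h, rfl, rfl⟩

lemma corner_notMem (N M : ℕ) (m : Fin (N + M) →₀ ℕ) : (N, M) ∉ boxM N M m := by
  rw [mem_boxM]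
  rintro (⟨i, h, -⟩ | ⟨j, h, -⟩)
  · have := i.2; simp only at h; omega
  · have := j.2; simp only at h; omega

lemma prod_Iio_castAdd {N M : ℕ} (g : Fin (N + M) → F) (i : Fin N) :
    ∏ l ∈ Finset.Iio (Fin.castAdd M i), g l = ∏ l ∈ Finset.Iio i, g (Fin.castAdd M l) := by
  symm
  apply Finset.prod_bij (fun l _ => Fin.castAdd M l)
  · intro l hl
    have h1 : (l : ℕ) < i := Fin.lt_def.mp (Finset.mem_Iio.mp hl)
    exact Finset.mem_Iio.mpr (Fin.lt_def.mpr h1)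
  · intro a _ b _ h
    simpa using h
  · intro b hb
    rw [Finset.mem_Iio] at hb
    have hb' : (b : ℕ) < i := hb
    exact ⟨⟨b, by omega⟩, by simpa [Fin.lt_def] using hb', by ext; simp⟩
  · intros; rfl

lemma Eig_eq {q t : F} (ht0 : t ≠ 0) (N M : ℕ) (m : Fin (N + M) →₀ ℕ) :
    Eig (alXY q t N M) (beXY q t N M) (gaXY q t N M) m = eig q t (boxM N M m) := by
  classical
  have hx : ∀ i : Fin N, alXY q t N M (Fin.castAdd M i) / beXY q t N M (Fin.castAdd M i) = t⁻¹ := by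
    intro i; simp [alXY, beXY]
  have hy : ∀ i : Fin M, alXY q t N M (Fin.natAdd N i) / beXY q t N M (Fin.natAdd N i) = q := by
    intro i; simp [alXY, beXY, ht0]
  have hpx : ∀ i : Fin N, ∏ l ∈ Finset.Iio (Fin.castAdd M i),
      alXY q t N M l / beXY q t N M l = t⁻¹ ^ (i : ℕ) := by
    intro i
    rw [prod_Iio_castAdd (fun l => alXY q t N M l / beXY q t N M l)]
    simp only [hx, Finset.prod_const, Fin.card_Iio]
  have hpy : ∀ j : Fin M, ∏ l ∈ Finset.Iio (Fin.natAdd N j),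
      alXY q t N M l / beXY q t N M l = t⁻¹ ^ N * q ^ (j : ℕ) := by
    intro j
    have h1 : ∏ l ∈ Finset.Iio (Fin.natAdd N j), alXY q t N M l / beXY q t N M l =
      ∏ l : Fin (N + M), if l < Fin.natAdd N j then alXY q t N M l / beXY q t N M l else 1 := by
      rw [← Finset.prod_filter]
      congr 1
      ext l
      simp
    rw [h1, Fin.prod_univ_add]
    simp only [hx, hy]
    have h2 : ∀ i : Fin N, Fin.castAdd M i < Fin.natAdd N j := by
      intro i
      rw [Fin.lt_def]
      simp only [Fin.val_castAdd, Fin.val_natAdd]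
      omega
    simp only [h2, if_true, Finset.prod_const, Finset.card_univ, Fintype.card_fin,
      Fin.natAdd_lt_natAdd_iff]
    rw [← Finset.prod_filter]
    simp only [Finset.prod_const]
    congr 2
    rw [show (Finset.univ.filter fun l : Fin M => l < j) = Finset.Iio j by ext l; simp,
      Fin.card_Iio]
  have hsum : ∑ p ∈ boxM N M m, t⁻¹ ^ p.1 * q ^ p.2 =
      (∑ i : Fin N, ∑ j ∈ Finset.range (m (Fin.castAdd M i)), t⁻¹ ^ (i : ℕ) * q ^ j) +
      ∑ j : Fin M, ∑ i ∈ Finset.range (m (Fin.natAdd N j)), t⁻¹ ^ (N + i) * q ^ (j : ℕ) := by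
    rw [boxM, Finset.sum_union, Finset.sum_biUnion, Finset.sum_biUnion]
    · congr 1
      · apply Finset.sum_congr rfl
        intro i _
        rw [Finset.sum_image (by intro a _ b _ h; simpa using h)]
      · apply Finset.sum_congr rfl
        intro i _
        rw [Finset.sum_image (by intro a _ b _ h; simpa using h)]
    · intro a _ b _ hab
      rw [Function.onFun, Finset.disjoint_left]
      simp only [Finset.mem_image]
      rintro p ⟨x, -, rfl⟩ ⟨y, -, h⟩
      simp only [Prod.mk.injEq] at h
      exact hab (Fin.ext h.2.symm)
    · intro a _ b _ hab
      rw [Function.onFun, Finset.disjoint_left]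
      simp only [Finset.mem_image]
      rintro p ⟨x, -, rfl⟩ ⟨y, -, h⟩
      simp only [Prod.mk.injEq] at h
      exact hab (Fin.ext h.1.symm)
    · rw [Finset.disjoint_left]
      simp only [Finset.mem_biUnion, Finset.mem_image, Finset.mem_univ, true_and]
      rintro p ⟨i, x, -, rfl⟩ ⟨j, y, -, h⟩
      simp only [Prod.mk.injEq] at h
      have := i.2
      omega
  rw [Eig, eig, hsum, Fin.sum_univ_add]
  simp only [hx, hy, hpx, hpy]
  simp only [gaXY, Fin.addCases_left, Fin.addCases_right, pow_add, ← Finset.mul_sum,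
    ← Finset.sum_mul]
  have hg : ∀ (x : F) (n : ℕ), x ^ n - 1 = (∑ i ∈ Finset.range n, x ^ i) * (x - 1) :=
    fun x n => (geom_sum_mul x n).symm
  simp only [hg]
  have e : ∀ a b c : F, a + b = -c → 1 + (a + b) = 1 - c := by
    intro a b c h
    rw [h]; ring
  apply e
  rw [mul_add, neg_add, Finset.mul_sum, Finset.mul_sum, ← Finset.sum_neg_distrib,
    ← Finset.sum_neg_distrib]
  congr 1
  · apply Finset.sum_congr rfl
    intro i _
    ring
  · apply Finset.sum_congr rfl
    intro i _
    ring

end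

section
/-! ### self-adjointness -/

lemma Sop_scale [CharZero F] (a : F) (v : ℕ → F) (r : ℕ) : ∀ f : Sym F,
    Sop (fun k => a ^ (k + 1) * v k) r f = a ^ r • Sop v r f := by
  induction r using Nat.strong_induction_on with
  | _ r ih =>
  intro f
  rcases Nat.eq_zero_or_pos r with h0 | h0
  · subst h0
    rw [Sop_zero, Sop_zero, pow_zero, one_smul]
  have hr : (r : F) ≠ 0 := by exact_mod_cast h0.ne'
  apply smul_right_injective _ hr
  change (r : F) • _ = (r : F) • _
  rw [Sop_rec, smul_comm, Sop_rec, Finset.smul_sum]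
  apply Finset.sum_congr rfl
  intro k hk
  rw [Finset.mem_range] at hk
  rw [ih _ (by omega), smul_smul, smul_smul]
  congr 1
  have : a ^ r = a ^ (k + 1) * a ^ (r - 1 - k) := by
    rw [← pow_add]; congr 1; omega
  rw [this]
  ring

lemma Dop_hom [CharZero F] {q s : F} {f : Sym F} {d : ℕ} (h : Hom f d) : Hom (Dop q s f) d := by
  rw [Dop_apply q s f (Nat.lt_succ_self _)]
  apply MvPolynomial.IsWeightedHomogeneous.sum
  intro r _
  by_cases hr : r ≤ d
  · have := (Kel_hom (fun k => 1 - s ^ (k + 1)) r).mul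
      (Sop_hom (v := fun k => -(1 - q ^ (k + 1))) (a := d - r) (r := r)
        (by rwa [Nat.sub_add_cancel hr]))
    rwa [Nat.add_sub_cancel' hr] at this
  · rw [Sop_eq_zero h (by omega), mul_zero]
    exact MvPolynomial.isWeightedHomogeneous_zero _ _ _

/-- the genericity assumptions on `(q,t)` -/
structure Gen (q t : F) : Prop where
  ht0 : t ≠ 0
  hq : ∀ k : ℕ, 1 - q ^ (k + 1) ≠ 0
  ht : ∀ k : ℕ, 1 - t ^ (k + 1) ≠ 0
  hinj : ∀ S T : Finset (ℕ × ℕ),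
    ∑ p ∈ S, t⁻¹ ^ p.1 * q ^ p.2 = ∑ p ∈ T, t⁻¹ ^ p.1 * q ^ p.2 → S = T

lemma Gen.hw {q t : F} (h : Gen q t) (n : ℕ) : wqt q t n ≠ 0 := div_ne_zero (h.hq n) (h.ht n)

lemma Gen.eig_inj {q t : F} (h : Gen q t) {S T : Finset (ℕ × ℕ)} (he : eig q t S = eig q t T) :
    S = T := by
  apply h.hinj
  have h1 : (1 - t⁻¹) * (1 - q) ≠ 0 := by
    apply mul_ne_zero
    · have h2 := h.ht 0
      have h3 := h.ht0
      intro h4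
      apply h2
      have h5 : t⁻¹ = 1 := (sub_eq_zero.mp h4).symm
      rw [inv_eq_one] at h5
      simp [h5]
    · simpa using h.hq 0
  simp only [eig] at he
  exact mul_left_cancel₀ h1 (sub_right_injective he)

lemma Dop_adj [CharZero F] {q t : F} (h : Gen q t) (f g : Sym F) :
    ip (wqt q t) (Dop q t⁻¹ f) g = ip (wqt q t) f (Dop q t⁻¹ g) := by
  set v : ℕ → F := fun k => -(1 - q ^ (k + 1)) with hv
  have hc : ∀ k : ℕ, (1 - t⁻¹ ^ (k + 1)) * wqt q t k = t⁻¹ ^ (k + 1) * v k := by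
    intro k
    simp only [wqt, hv, inv_pow]
    have := h.ht k
    have h0 : t ^ (k + 1) ≠ 0 := pow_ne_zero _ h.ht0
    generalize t ^ (k + 1) = T at *
    field_simp
    ring
  have key : ∀ f g : Sym F, ∀ r, ip (wqt q t) f (Kel (fun k => 1 - t⁻¹ ^ (k + 1)) r * g) =
      t⁻¹ ^ r * ip (wqt q t) (Sop v r f) g := by
    intro f g r
    rw [ip_Kel_mul (c := fun k => 1 - t⁻¹ ^ (k + 1)) (v := fun k => t⁻¹ ^ (k + 1) * v k) hc,
      Sop_scale, map_smul, LinearMap.smul_apply, smul_eq_mul]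
  set N := max (psi v f).natDegree (psi v g).natDegree + 1
  rw [Dop_apply q t⁻¹ f (N := N) (Nat.lt_succ_of_le (le_max_left _ _)),
    Dop_apply q t⁻¹ g (N := N) (Nat.lt_succ_of_le (le_max_right _ _)), ip_comm, map_sum, map_sum]
  apply Finset.sum_congr rfl
  intro r _
  rw [key, key, ip_comm]

/-! ### boxes and exponents of partitions -/

/-- the diagram of a partition -/
def boxes (lam : Partition) : Finset (ℕ × ℕ) :=
  (Finset.range lam.size).biUnion fun i => (Finset.range (lam.part i)).image fun j => (i, j)

lemma mem_boxes {lam : Partition} {p : ℕ × ℕ} : p ∈ boxes lam ↔ p.2 < lam.part p.1 := by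
  obtain ⟨x, y⟩ := p
  simp only [boxes, Finset.mem_biUnion, Finset.mem_range, Finset.mem_image, Prod.mk.injEq]
  constructor
  · rintro ⟨i, hi, j, hj, rfl, rfl⟩
    exact hj
  · intro h
    refine ⟨x, ?_, y, h, rfl, rfl⟩
    by_contra hx
    rw [part_eq_zero lam (not_lt.mp hx)] at h
    omega

lemma boxes_inj {a b : Partition} (h : boxes a = boxes b) : a = b := by
  apply Partition.ext'
  intro j
  have h1 : ∀ y, y < a.part j ↔ y < b.part j := by
    intro y
    have := mem_boxes (lam := a) (p := (j, y))
    rw [h, mem_boxes] at this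
    exact this.symm
  have h2 := h1 (a.part j)
  have h3 := h1 (b.part j)
  omega

/-- the exponent vector of a partition -/
def ev (L : ℕ) (lam : Partition) : Fin L →₀ ℕ := Finsupp.equivFunOnFinite.symm fun i => lam.part i

lemma ev_apply (L : ℕ) (lam : Partition) (i : Fin L) : ev L lam i = lam.part i := rfl

lemma ev_inj {L : ℕ} {a b : Partition} (ha : a.size ≤ L) (hb : b.size ≤ L) (h : ev L a = ev L b) :
    a = b := by
  apply Partition.ext'
  intro j
  by_cases hj : j < L
  · have := DFunLike.congr_fun h ⟨j, hj⟩
    exact this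
  · rw [part_eq_zero a (by omega), part_eq_zero b (by omega)]

lemma boxM_ev {L : ℕ} {lam : Partition} (h : lam.size ≤ L) : boxM L 0 (ev (L + 0) lam) = boxes lam := by
  ext p
  rw [mem_boxM, mem_boxes]
  constructor
  · rintro (⟨i, hi, h2⟩ | ⟨j, -⟩)
    · rw [hi]; exact h2
    · exact j.elim0
  · intro h2
    left
    have : p.1 < L := by
      by_contra h3
      rw [part_eq_zero lam (by omega)] at h2
      omega
    exact ⟨⟨p.1, this⟩, rfl, h2⟩

lemma psum_eq_sum_Iic (lam : Partition) {L : ℕ} (i : Fin L) :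
    lam.psum (i + 1) = ∑ j ∈ Finset.Iic i, ev L lam j := by
  rw [Partition.psum]
  symm
  apply Finset.sum_bij (fun (j : Fin L) _ => (j : ℕ))
  · intro a ha
    rw [Finset.mem_range, Nat.lt_succ_iff]
    exact Fin.le_def.mp (Finset.mem_Iic.mp ha)
  · intro a _ b _ hab
    exact Fin.ext hab
  · intro b hb
    rw [Finset.mem_range] at hb
    have := i.2
    exact ⟨⟨b, by omega⟩, by rw [Finset.mem_Iic, Fin.le_def]; simp only; omega, rfl⟩
  · intros; rfl

/-! ### monomial coefficients -/

lemma coeff_phi_one [CharZero F] (q t : F) (L : ℕ) (m : Fin (L + 0) →₀ ℕ) (f : Sym F) :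
    (phi (thXY q t L 0) f).coeff m = ip (w1 F) f (∏ i, Kel (fun _ => (1 : F)) (m i)) := by
  apply coeff_phi (w := w1 F) (thXY q t L 0) (fun _ _ => 1)
  intro i k
  refine Fin.addCases (fun i => ?_) (fun i => i.elim0) i
  simp only [w1, mul_one, thXY, Fin.addCases_left]

lemma coeff_phi_ev [CharZero F] (q t : F) {L : ℕ} {lam : Partition} (h : lam.size ≤ L) (f : Sym F) :
    (phi (thXY q t L 0) f).coeff (ev (L + 0) lam) = ip (w1 F) f (hprod F lam) := by
  rw [coeff_phi_one, hprod_eq lam (n := L + 0) fun j hj => part_eq_zero lam (by omega)]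
  rfl

lemma coeff_phi_sort [CharZero F] (q t : F) {L : ℕ} (m : Fin (L + 0) →₀ ℕ) : ∃ k : Partition,
    (∀ f : Sym F, (phi (thXY q t L 0) f).coeff m = ip (w1 F) f (hprod F k)) ∧
    (∀ j, L ≤ j → k.part j = 0) ∧
    ∀ i : Fin (L + 0), ∑ j ∈ Finset.Iic i, m j ≤ k.psum (i + 1) := by
  obtain ⟨k, h1, h2, h3, h4⟩ := exists_sort' (F := F) (n := L + 0) m
  refine ⟨k, ?_, h1, ?_⟩
  · intro f
    rw [coeff_phi_one, h2]
  · intro i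
    have := h4 (Finset.Iic i)
    rwa [Fin.card_Iic] at this

lemma phi_one_inj [CharZero F] (q t : F) {L d : ℕ} (hd : d ≤ L) {f : Sym F} (hf : Hom f d)
    (h : phi (thXY q t L 0) f = 0) : f = 0 := by
  apply Hall_nondeg
  intro k
  by_cases hk : k.size = d
  · rw [← coeff_phi_ev q t (L := L) (by omega), h, MvPolynomial.coeff_zero]
  · exact ip_hom_ne hf (hprod_hom k) (Ne.symm hk)

/-! ### the basis of Macdonald polynomials -/

/-- the properties defining Macdonald polynomials -/
structure Mac (q t : F) (P : Partition → Sym F) : Prop where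
  orth : ∀ lam mu, lam ≠ mu → ip (wqt q t) (P lam) (P mu) = 0
  one : ∀ lam, ip (w1 F) (P lam) (hprod F lam) = 1
  tri : ∀ lam mu, ¬ Partition.Dominates lam mu → ip (w1 F) (P lam) (hprod F mu) = 0

lemma IsMacdonald.mac {q t : F} (h : Gen q t) {P : Partition → Sym F} (hP : IsMacdonald q t P) :
    Mac q t P := by
  have hw : (fun n => (1 - t ^ (n + 1)) / (1 - t ^ (n + 1))) = w1 F := by
    funext n
    exact div_self (h.ht n)
  obtain ⟨h1, h2, h3⟩ := hP
  refine ⟨?_, ?_, ?_⟩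
  · intro lam mu hlm
    have := h1 lam mu hlm
    rwa [innerQT_eq] at this
  · intro lam
    have := h2 lam
    rwa [innerQT_eq, hw] at this
  · intro lam mu hlm
    have := h3 lam mu hlm
    rwa [innerQT_eq, hw] at this

variable {q t : F} {P : Partition → Sym F}

lemma Mac.hom [CharZero F] (hP : Mac q t P) (lam : Partition) : Hom (P lam) lam.size := by
  apply hom_of_ip (w := w1 F) (by simp)
  intro b g hg hb
  rw [← ip_component hg]
  have : MvPolynomial.weightedHomogeneousComponent wts b (P lam) = 0 := by
    apply Hall_nondeg
    intro k
    by_cases hk : k.size = b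
    · rw [ip_component (by rw [← hk]; exact hprod_hom k)]
      apply hP.tri
      intro h
      exact hb (hk.symm.trans h.1)
    · exact ip_hom_ne (MvPolynomial.weightedHomogeneousComponent_isWeightedHomogeneous _ _)
        (hprod_hom k) (Ne.symm hk)
  rw [this, map_zero, LinearMap.zero_apply]

lemma Mac.ldP [CharZero F] (hP : Mac q t P) {lam : Partition} {L : ℕ} (h : lam.size ≤ L) :
    Ld (phi (thXY q t L 0) (P lam)) (ev (L + 0) lam) 1 := by
  refine ⟨?_, by rw [coeff_phi_ev q t h, hP.one]⟩
  rw [MonomialOrder.degree_le_iff]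
  intro e he
  rw [MvPolynomial.mem_support_iff] at he
  obtain ⟨k, h1, h2, h3⟩ := coeff_phi_sort (F := F) q t e
  rw [h1] at he
  have hd : Partition.Dominates lam k := by
    by_contra hd
    exact he (hP.tri lam k hd)
  apply lex_le_of_psum
  intro i
  rw [← psum_eq_sum_Iic]
  exact (h3 i).trans (hd.2 _)

lemma Mac.ne_zero (hP : Mac q t P) (lam : Partition) : P lam ≠ 0 := by
  intro h
  have := hP.one lam
  rw [h, map_zero, LinearMap.zero_apply] at this
  exact zero_ne_one this

/-- the lexicographic leading exponent -/
abbrev lexdeg (q t : F) (d : ℕ) (f : Sym F) : Fin (d + 0) →₀ ℕ :=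
  (MonomialOrder.lex (σ := Fin (d + 0))).degree (phi (thXY q t d 0) f)

lemma Mac.elim_aux [CharZero F] (hP : Mac q t P) {d : ℕ} {f : Sym F} (hf : Hom f d) (h0 : f ≠ 0) :
    ∃ k : Partition, k.size = d ∧ ev (d + 0) k = lexdeg q t d f ∧
      ip (w1 F) f (hprod F k) ≠ 0 ∧
      Ld (phi (thXY q t d 0) (f - ip (w1 F) f (hprod F k) • P k)) (ev (d + 0) k) 0 := by
  have hphi : phi (thXY q t d 0) f ≠ 0 := fun h => h0 (phi_one_inj q t le_rfl hf h)
  obtain ⟨k, h1, h2, h3⟩ := coeff_phi_sort (F := F) q t (lexdeg q t d f)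
  have hc : ip (w1 F) f (hprod F k) ≠ 0 := by
    rw [← h1]
    have := (MonomialOrder.lex (σ := Fin (d + 0))).leadingCoeff_ne_zero_iff.mpr hphi
    exact this
  have hk : k.size = d := by
    by_contra hk
    exact hc (ip_hom_ne hf (hprod_hom k) (Ne.symm hk))
  have hev : ev (d + 0) k = lexdeg q t d f := by
    apply (MonomialOrder.lex (σ := Fin (d + 0))).toSyn.injective
    apply le_antisymm
    · apply MonomialOrder.le_degree
      rw [MvPolynomial.mem_support_iff, coeff_phi_ev q t hk.le]
      exact hc
    · apply lex_le_of_psum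
      intro i
      rw [← psum_eq_sum_Iic]
      exact h3 i
  refine ⟨k, hk, hev, hc, ?_⟩
  have h4 : Ld (phi (thXY q t d 0) f) (lexdeg q t d f)
    ((phi (thXY q t d 0) f).coeff (lexdeg q t d f)) := Ld.of_degree (phi (thXY q t d 0) f)
  rw [← hev, coeff_phi_ev q t hk.le] at h4
  have h5 := h4.sub ((hP.ldP hk.le).smul (ip (w1 F) f (hprod F k)))
  rw [mul_one, sub_self, ← map_smul, ← map_sub] at h5
  exact h5

lemma Mac.span [CharZero F] (hP : Mac q t P) {d : ℕ} : ∀ {f : Sym F}, Hom f d →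
    f ∈ Submodule.span F (P '' {k | k.size = d ∧
      (MonomialOrder.lex (σ := Fin (d + 0))).toSyn (ev (d + 0) k) ≤
        (MonomialOrder.lex (σ := Fin (d + 0))).toSyn (lexdeg q t d f)}) := by
  have key : ∀ x : (MonomialOrder.lex (σ := Fin (d + 0))).syn, ∀ f : Sym F, Hom f d →
      (MonomialOrder.lex (σ := Fin (d + 0))).toSyn (lexdeg q t d f) = x →
      f ∈ Submodule.span F (P '' {k | k.size = d ∧
      (MonomialOrder.lex (σ := Fin (d + 0))).toSyn (ev (d + 0) k) ≤ x}) := by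
    intro x
    induction x using WellFoundedLT.induction with
    | ind x ih =>
    intro f hf hx
    by_cases h0 : f = 0
    · rw [h0]; exact Submodule.zero_mem _
    obtain ⟨k, hk, hev, hc, hl⟩ := hP.elim_aux hf h0
    set c := ip (w1 F) f (hprod F k) with hcdef
    have hkmem : P k ∈ Submodule.span F (P '' {k | k.size = d ∧
        (MonomialOrder.lex (σ := Fin (d + 0))).toSyn (ev (d + 0) k) ≤ x}) := by
      apply Submodule.subset_span
      exact ⟨k, ⟨hk, by rw [hev, hx]⟩, rfl⟩
    have hg : Hom (f - c • P k) d := by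
      have h1 := hP.hom k
      rw [hk] at h1
      rw [sub_eq_add_neg, ← neg_smul]
      exact hf.add (h1.smul _)
    have : f - c • P k ∈ Submodule.span F (P '' {k | k.size = d ∧
        (MonomialOrder.lex (σ := Fin (d + 0))).toSyn (ev (d + 0) k) ≤ x}) := by
      by_cases hg0 : f - c • P k = 0
      · rw [hg0]; exact Submodule.zero_mem _
      have hlt : (MonomialOrder.lex (σ := Fin (d + 0))).toSyn (lexdeg q t d (f - c • P k)) < x := by
        rw [← hx, ← hev]
        apply lt_of_le_of_ne hl.1
        intro h
        have h1 := (MonomialOrder.lex (σ := Fin (d + 0))).toSyn.injective h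
        have h2 := hl.2
        rw [← h1] at h2
        apply hg0
        apply phi_one_inj q t le_rfl hg
        exact (MonomialOrder.lex (σ := Fin (d + 0))).leadingCoeff_eq_zero_iff.mp h2
      refine Submodule.span_mono ?_ (ih _ hlt _ hg rfl)
      apply Set.image_mono
      rintro j ⟨h1, h2⟩
      exact ⟨h1, h2.trans hlt.le⟩
    have h3 := Submodule.add_mem _ this (Submodule.smul_mem _ c hkmem)
    rwa [sub_add_cancel] at h3
  intro f hf
  exact key _ f hf rfl

lemma Mac.span' [CharZero F] (hP : Mac q t P) {d : ℕ} {f : Sym F} (hf : Hom f d) :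
    f ∈ Submodule.span F (P '' {k | k.size = d}) :=
  Submodule.span_mono (Set.image_mono fun _ hk => hk.1) (hP.span hf)

lemma Mac.norm_ne [CharZero F] (h : Gen q t) (hP : Mac q t P) (lam : Partition) :
    ip (wqt q t) (P lam) (P lam) ≠ 0 := by
  intro h0
  apply hP.ne_zero lam
  have h1 : ∀ g, Hom g lam.size → ip (wqt q t) (P lam) g = 0 := by
    intro g hg
    have := hP.span' hg
    clear hg
    induction this using Submodule.span_induction with
    | mem x hx =>
      obtain ⟨k, -, rfl⟩ := hx
      by_cases hk : lam = k
      · rw [← hk]; exact h0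
      · exact hP.orth _ _ hk
    | zero => simp
    | add x y _ _ h1 h2 => rw [map_add, h1, h2, add_zero]
    | smul a x _ h1 => rw [map_smul, h1, smul_zero]
  apply ip_nondeg h.hw
  intro g
  rw [ip_comm, ← ip_component (hP.hom lam), ip_comm]
  exact h1 _ (MvPolynomial.weightedHomogeneousComponent_isWeightedHomogeneous _ _)

/-- partitions of a given size -/
def parts (d : ℕ) : Finset Partition := (size_finite d).toFinset

lemma mem_parts {d : ℕ} {k : Partition} : k ∈ parts d ↔ k.size = d := by simp [parts]

lemma Mac.expand [CharZero F] (h : Gen q t) (hP : Mac q t P) {d : ℕ} {f : Sym F} (hf : Hom f d) :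
    f = ∑ k ∈ parts d, ((ip (wqt q t) (P k) (P k))⁻¹ * ip (wqt q t) (P k) f) • P k := by
  classical
  have := hP.span' hf
  clear hf
  induction this using Submodule.span_induction with
  | mem x hx =>
    obtain ⟨k, hk, rfl⟩ := hx
    rw [Finset.sum_eq_single k]
    · rw [inv_mul_cancel₀ (hP.norm_ne h k), one_smul]
    · intro j _ hj
      rw [hP.orth _ _ hj, mul_zero, zero_smul]
    · intro h2
      exact absurd (mem_parts.mpr hk) h2
  | zero => simp
  | add x y _ _ h1 h2 =>
    conv_lhs => rw [h1, h2]
    rw [← Finset.sum_add_distrib]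
    apply Finset.sum_congr rfl
    intro k _
    rw [← add_smul, map_add, mul_add]
  | smul a x _ h1 =>
    conv_lhs => rw [h1]
    rw [Finset.smul_sum]
    apply Finset.sum_congr rfl
    intro k _
    rw [smul_smul, map_smul, smul_eq_mul]
    congr 1
    ring

lemma Mac.Dop_P [CharZero F] (h : Gen q t) (hP : Mac q t P) (lam : Partition) :
    Dop q t⁻¹ (P lam) = eig q t (boxes lam) • P lam := by
  classical
  have hD : ∀ mu : Partition, Ld (phi (thXY q t mu.size 0) (Dop q t⁻¹ (P mu)))
      (ev (mu.size + 0) mu) (eig q t (boxes mu) * 1) := by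
    intro mu
    have := Ld_Dop (parXY (q := q) h.ht0 h.ht mu.size 0) (hP.ldP (le_refl mu.size))
    rwa [Eig_eq h.ht0, boxM_ev le_rfl] at this
  have hlow : ∀ k mu : Partition, k.size = mu.size →
      ip (wqt q t) (P k) (Dop q t⁻¹ (P mu)) ≠ 0 →
      (MonomialOrder.lex (σ := Fin (mu.size + 0))).toSyn (ev (mu.size + 0) k) ≤
        (MonomialOrder.lex (σ := Fin (mu.size + 0))).toSyn (ev (mu.size + 0) mu) := by
    intro k mu hk hne
    by_contra hcon
    apply hne
    have h1 := hP.span (Dop_hom (q := q) (s := t⁻¹) (hP.hom mu))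
    refine Submodule.span_induction (p := fun x _ => ip (wqt q t) (P k) x = 0) ?_ ?_ ?_ ?_ h1
    · rintro _ ⟨j, ⟨-, hj⟩, rfl⟩
      apply hP.orth
      rintro rfl
      exact hcon (hj.trans (hD mu).1)
    · simp
    · intro x y _ _ h1 h2
      rw [map_add, h1, h2, add_zero]
    · intro a x _ h1
      rw [map_smul, h1, smul_zero]
  have h1 : ∃ c : F, Dop q t⁻¹ (P lam) = c • P lam := by
    have h2 := hP.expand h (Dop_hom (q := q) (s := t⁻¹) (hP.hom lam))
    rw [Finset.sum_eq_single lam] at h2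
    · exact ⟨_, h2⟩
    · intro k hk hkl
      rw [mem_parts] at hk
      by_contra hne
      have h3 : ip (wqt q t) (P k) (Dop q t⁻¹ (P lam)) ≠ 0 := by
        intro h4
        rw [h4, mul_zero, zero_smul] at hne
        exact hne rfl
      have h4 := hlow k lam hk h3
      rw [← Dop_adj h, ip_comm] at h3
      have h5 := hlow lam k hk.symm h3
      rw [hk] at h5
      apply hkl
      apply ev_inj (L := lam.size + 0) hk.le le_rfl
      exact (MonomialOrder.lex (σ := Fin (lam.size + 0))).toSyn.injective (le_antisymm h4 h5)
    · intro h3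
      exact absurd (mem_parts.mpr rfl) h3
  obtain ⟨c, hc⟩ := h1
  have h2 := (hD lam).2
  rw [hc, map_smul, MvPolynomial.coeff_smul, (hP.ldP le_rfl).2, smul_eq_mul, mul_one, mul_one] at h2
  rw [hc, h2]

end

section
/-! ### polynomials in the operator -/

section
variable {q s : F} {L : ℕ} {θ : Fin L → ℕ → F} {α β γ : Fin L → F}

lemma Ld_aeval [CharZero F] (hp : Par q s θ α β γ) (p : Polynomial F) :
    ∀ {f : Sym F} {m : Fin L →₀ ℕ} {c : F}, Ld (phi θ f) m c →
      Ld (phi θ (Polynomial.aeval (Dop q s) p f)) m (p.eval (Eig α β γ m) * c) := by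
  induction p using Polynomial.induction_on with
  | C a =>
    intro f m c h
    simpa [Polynomial.aeval_C, Module.algebraMap_end_apply] using h.smul a
  | add p r hp hr =>
    intro f m c h
    have := (hp h).add (hr h)
    rwa [← map_add, ← LinearMap.add_apply, ← map_add, ← add_mul, ← Polynomial.eval_add] at this
  | monomial n a ih =>
    intro f m c h
    have := ih (Ld_Dop hp h)
    rw [pow_succ, ← mul_assoc, map_mul, Polynomial.aeval_X, Module.End.mul_apply,
      Polynomial.eval_mul, Polynomial.eval_X, mul_assoc]
    exact this

lemma phi_aeval_zero [CharZero F] (hp : Par q s θ α β γ) (p : Polynomial F) :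
    ∀ {f : Sym F}, phi θ f = 0 → phi θ (Polynomial.aeval (Dop q s) p f) = 0 := by
  induction p using Polynomial.induction_on with
  | C a =>
    intro f h
    simp [Polynomial.aeval_C, Module.algebraMap_end_apply, h]
  | add p r hp hr =>
    intro f h
    rw [map_add, LinearMap.add_apply, map_add, hp h, hr h, add_zero]
  | monomial n a ih =>
    intro f h
    have := ih (phi_Dop_zero hp h)
    rw [pow_succ, ← mul_assoc, map_mul, Polynomial.aeval_X, Module.End.mul_apply]
    exact this

lemma aeval_eigen (p : Polynomial F) {f : Sym F} {e : F} (h : Dop q s f = e • f) :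
    Polynomial.aeval (Dop q s) p f = p.eval e • f := by
  induction p using Polynomial.induction_on with
  | C a => simp [Polynomial.aeval_C, Module.algebraMap_end_apply]
  | add p r hp hr => rw [map_add, LinearMap.add_apply, hp, hr, Polynomial.eval_add, add_smul]
  | monomial n a ih =>
    rw [pow_succ, ← mul_assoc, map_mul, Polynomial.aeval_X, Module.End.mul_apply, h, map_smul, ih,
      Polynomial.eval_mul (q := Polynomial.X), Polynomial.eval_X, smul_smul, mul_comm]

end

variable {q t : F} {P : Partition → Sym F}

lemma Mac.kill [CharZero F] (h : Gen q t) (hP : Mac q t P) {d : ℕ} {f : Sym F} (hf : Hom f d)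
    {k : Partition} (hk : k.size = d) : ∃ p : Polynomial F, p.eval (eig q t (boxes k)) ≠ 0 ∧
    Polynomial.aeval (Dop q t⁻¹) p f = (((ip (wqt q t) (P k) (P k))⁻¹ * ip (wqt q t) (P k) f) *
      p.eval (eig q t (boxes k))) • P k := by
  classical
  set p : Polynomial F := ∏ j ∈ (parts d).erase k,
    (Polynomial.X - Polynomial.C (eig q t (boxes j))) with hp
  have hev : ∀ x, p.eval x = ∏ j ∈ (parts d).erase k, (x - eig q t (boxes j)) := by
    intro x
    rw [hp, Polynomial.eval_prod]
    simp
  refine ⟨p, ?_, ?_⟩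
  · rw [hev, Finset.prod_ne_zero_iff]
    intro j hj h0
    have := boxes_inj (h.eig_inj (sub_eq_zero.mp h0))
    exact Finset.ne_of_mem_erase hj this.symm
  · conv_lhs => rw [hP.expand h hf]
    rw [map_sum, Finset.sum_eq_single k]
    · rw [map_smul, aeval_eigen p (hP.Dop_P h k), smul_smul]
    · intro j hj hjk
      rw [map_smul, aeval_eigen p (hP.Dop_P h j), hev,
        Finset.prod_eq_zero (Finset.mem_erase.mpr ⟨hjk, hj⟩) (sub_self _), zero_smul, smul_zero]
    · intro h2
      exact absurd (mem_parts.mpr hk) h2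

lemma Mac.ker_coef [CharZero F] (h : Gen q t) (hP : Mac q t P) {N M d : ℕ} {f : Sym F}
    (hf : Hom f d) (h0 : phi (thXY q t N M) f = 0) {k : Partition} (hk : k.size = d)
    (hne : ip (wqt q t) (P k) f ≠ 0) : phi (thXY q t N M) (P k) = 0 := by
  obtain ⟨p, h1, h2⟩ := hP.kill h hf hk
  have h3 := phi_aeval_zero (parXY (q := q) h.ht0 h.ht N M) p h0
  rw [h2, map_smul] at h3
  exact (smul_eq_zero.mp h3).resolve_left
    (mul_ne_zero (mul_ne_zero (inv_ne_zero (hP.norm_ne h k)) hne) h1)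

lemma Mac.phi_eq_zero [CharZero F] (h : Gen q t) (hP : Mac q t P) {N M : ℕ} {mu : Partition}
    (hmu : M < mu.part N) : phi (thXY q t N M) (P mu) = 0 := by
  by_contra hne
  set g := phi (thXY q t N M) (P mu) with hg
  have h1 := Ld.of_degree g
  set m := (MonomialOrder.lex (σ := Fin (N + M))).degree g with hm
  have hc : g.coeff m ≠ 0 :=
    (MonomialOrder.lex (σ := Fin (N + M))).leadingCoeff_ne_zero_iff.mpr hne
  have h2 := (Ld_Dop (parXY (q := q) h.ht0 h.ht N M) h1).2
  rw [hP.Dop_P h, map_smul, MvPolynomial.coeff_smul, smul_eq_mul, Eig_eq h.ht0] at h2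
  have h3 := h.eig_inj (mul_right_cancel₀ hc h2)
  apply corner_notMem N M m
  rw [← h3, mem_boxes]
  exact hmu

lemma Mac.coef_le [CharZero F] (hP : Mac q t P) {d : ℕ} {f : Sym F} (hf : Hom f d)
    {k : Partition} (hne : ip (wqt q t) (P k) f ≠ 0) :
    (MonomialOrder.lex (σ := Fin (d + 0))).toSyn (ev (d + 0) k) ≤
      (MonomialOrder.lex (σ := Fin (d + 0))).toSyn (lexdeg q t d f) := by
  by_contra hcon
  apply hne
  refine Submodule.span_induction (p := fun x _ => ip (wqt q t) (P k) x = 0) ?_ ?_ ?_ ?_ (hP.span hf)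
  · rintro _ ⟨j, ⟨-, hj⟩, rfl⟩
    apply hP.orth
    rintro rfl
    exact hcon hj
  · simp
  · intro x y _ _ h1 h2
    rw [map_add, h1, h2, add_zero]
  · intro a x _ h1
    rw [map_smul, h1, smul_zero]

/-! ### elementary symmetric functions in the dual variables -/

lemma phi_esymm [CharZero F] (h : Gen q t) (M r : ℕ) :
    phi (thXY q t 0 M) (Kel (fun k => (-1) ^ k / (-wqt q t k)) r) =
      MvPolynomial.esymm (Fin (0 + M)) F r := by
  have hX : ∀ k, phi (thXY q t 0 M) (MvPolynomial.X k) =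
      (-wqt q t k) • MvPolynomial.psum (Fin (0 + M)) F (k + 1) := by
    intro k
    rw [phi_X, MvPolynomial.psum, Finset.smul_sum]
    apply Finset.sum_congr rfl
    intro i _
    rw [MvPolynomial.smul_eq_C_mul]
    refine Fin.addCases (fun i => i.elim0) (fun i => ?_) i
    simp only [thXY, Fin.addCases_right]
  induction r using Nat.strong_induction_on with
  | _ r ih =>
  rcases Nat.eq_zero_or_pos r with h0 | h0
  · subst h0
    rw [Kel_zero, map_one, MvPolynomial.esymm_zero]
  have hr : (r : F) ≠ 0 := by exact_mod_cast h0.ne'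
  apply smul_right_injective _ hr
  change (r : F) • _ = (r : F) • _
  rw [← map_smul, Kel_rec, map_sum]
  have hN := MvPolynomial.mul_esymm_eq_sum (Fin (0 + M)) F r
  have h3 : (r : F) • MvPolynomial.esymm (Fin (0 + M)) F r =
      (r : MvPolynomial (Fin (0 + M)) F) * MvPolynomial.esymm (Fin (0 + M)) F r := by
    rw [MvPolynomial.smul_eq_C_mul]
    simp
  rw [h3, hN, Finset.mul_sum, Finset.sum_filter, Finset.Nat.sum_antidiagonal_eq_sum_range_succ_mk,
    Finset.sum_range_succ, if_neg (by simp), add_zero, ← Finset.sum_range_reflect]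
  apply Finset.sum_congr rfl
  intro k hk
  rw [Finset.mem_range] at hk
  rw [if_pos (by simp only; omega), map_smul, map_mul, hX, ih _ (by omega)]
  have hw := h.hw (r - 1 - k)
  rw [smul_mul_assoc, smul_smul, div_mul_cancel₀ _ (neg_ne_zero.mpr hw)]
  have e1 : r - 1 - (r - 1 - k) = k := by omega
  have e3 : r - 1 - k + 1 = r - k := by omega
  simp only [e1, e3]
  have e2 : (-1 : MvPolynomial (Fin (0 + M)) F) ^ (r + 1) * (-1) ^ k = (-1) ^ (r - 1 - k) := by
    rw [← pow_add, show r + 1 + k = 2 * (k + 1) + (r - 1 - k) by omega, pow_add, pow_mul]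
    simp
  rw [← mul_assoc, ← mul_assoc, e2, MvPolynomial.smul_eq_C_mul]
  simp only [map_pow, map_neg, map_one]
  ring

/-- exponent of the leading term of an elementary symmetric polynomial -/
def eexp (L r : ℕ) : Fin L →₀ ℕ := Finsupp.equivFunOnFinite.symm fun i => if (i : ℕ) < r then 1 else 0

lemma Ld_esymm {L r : ℕ} (hr : r ≤ L) :
    Ld (MvPolynomial.esymm (Fin L) F r) (eexp L r) 1 := by
  classical
  set T0 : Finset (Fin L) := Finset.univ.filter fun i => (i : ℕ) < r with hT0
  have hT0c : T0.card = r := by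
    rw [hT0, Fin.card_filter_val_lt]
    omega
  have hind : ∀ (T : Finset (Fin L)) i, (∑ j ∈ T, Finsupp.single j 1 : Fin L →₀ ℕ) i =
      if i ∈ T then 1 else 0 := by
    intro T i
    rw [Finsupp.finsetSum_apply]
    simp [Finsupp.single_apply]
  have he : eexp L r = ∑ j ∈ T0, Finsupp.single j 1 := by
    ext i
    rw [hind]
    simp [eexp, hT0]
  have hT : ∀ T ∈ Finset.powersetCard r (Finset.univ : Finset (Fin L)),
      Ld (∏ i ∈ T, MvPolynomial.X i : MvPolynomial (Fin L) F) (eexp L r)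
        (if T = T0 then 1 else 0) := by
    intro T hT
    rw [Finset.mem_powersetCard] at hT
    have hmon : (∏ i ∈ T, MvPolynomial.X i : MvPolynomial (Fin L) F) =
        MvPolynomial.monomial (∑ j ∈ T, Finsupp.single j 1) 1 := by
      rw [MvPolynomial.monomial_sum_one]
      rfl
    rw [hmon]
    refine ⟨?_, ?_⟩
    · rw [MonomialOrder.degree_monomial, if_neg one_ne_zero]
      apply lex_le_of_psum
      intro i
      rw [he]
      simp only [hind]
      rw [Finset.sum_ite_mem, Finset.sum_ite_mem, Finset.sum_const, Finset.sum_const]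
      simp only [smul_eq_mul, mul_one]
      by_cases hi : (i : ℕ) < r
      · apply Finset.card_le_card
        intro j hj
        rw [Finset.mem_inter, Finset.mem_Iic] at hj ⊢
        refine ⟨hj.1, ?_⟩
        rw [hT0, Finset.mem_filter]
        exact ⟨Finset.mem_univ _, lt_of_le_of_lt (Fin.le_def.mp hj.1) hi⟩
      · have h1 : Finset.Iic i ∩ T0 = T0 := by
          apply Finset.inter_eq_right.mpr
          intro j hj
          rw [hT0, Finset.mem_filter] at hj
          rw [Finset.mem_Iic, Fin.le_def]
          omega
        rw [h1, hT0c, ← hT.2]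
        exact Finset.card_le_card Finset.inter_subset_right
    · rw [MvPolynomial.coeff_monomial, he]
      congr 1
      rw [eq_iff_iff]
      constructor
      · intro h1
        ext i
        have := DFunLike.congr_fun h1 i
        rw [hind, hind] at this
        by_cases h2 : i ∈ T <;> by_cases h3 : i ∈ T0
        · exact ⟨fun _ => h3, fun _ => h2⟩
        · rw [if_pos h2, if_neg h3] at this; omega
        · rw [if_neg h2, if_pos h3] at this; omega
        · exact ⟨fun h => absurd h h2, fun h => absurd h h3⟩
      · rintro rfl
        rfl
  have := Ld.sum _ hT
  rw [Finset.sum_ite_eq', if_pos] at this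
  · exact this
  · rw [Finset.mem_powersetCard]
    exact ⟨Finset.subset_univ _, hT0c⟩

end

section
variable {q t : F} {P : Partition → Sym F}

/-! ### non-vanishing -/

lemma Mac.phi_col_ne [CharZero F] (h : Gen q t) (hP : Mac q t P) {M : ℕ} {k : Partition}
    (hk : k.part 0 ≤ M) : phi (thXY q t 0 M) (P k) ≠ 0 := by
  classical
  intro h0
  set d := k.size with hd
  set f : Sym F := ∏ i : Fin d, Kel (fun j => (-1) ^ j / (-wqt q t j)) (k.part i) with hf
  have hfh : Hom f d := by
    have h1 : Hom f (∑ i : Fin d, k.part i) :=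
      MvPolynomial.IsWeightedHomogeneous.prod _ _ _ fun i _ => Kel_hom _ _
    have h2 : ∑ i : Fin d, k.part i = d := by
      rw [Fin.sum_univ_eq_sum_range (fun i => k.part i), hd]
      exact (size_eq_psum k fun j hj => part_eq_zero k hj).symm
    rwa [h2] at h1
  set m : Fin (0 + M) →₀ ℕ := ∑ i : Fin d, eexp (0 + M) (k.part i) with hm
  have hl : Ld (phi (thXY q t 0 M) f) m 1 := by
    have := Ld.prod (F := F) (L := 0 + M) (Finset.univ : Finset (Fin d))
      (f := fun i => phi (thXY q t 0 M) (Kel (fun j => (-1) ^ j / (-wqt q t j)) (k.part i)))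
      (m := fun i => eexp (0 + M) (k.part i)) (c := fun _ => 1) (by
        intro i _
        rw [phi_esymm h]
        apply Ld_esymm
        have := k.antitone' (Nat.zero_le i)
        omega)
    rw [← map_prod, Finset.prod_const_one] at this
    exact this
  have hbox : boxM 0 M m = boxes k := by
    ext ⟨x, y⟩
    rw [mem_boxM, mem_boxes]
    have hmy : ∀ j : Fin M, m (Fin.natAdd 0 j) = ((Finset.range d).filter fun i => (j : ℕ) < k.part i).card := by
      intro j
      rw [hm, Finsupp.finsetSum_apply]
      simp only [eexp, Finsupp.equivFunOnFinite_symm_apply_apply, Fin.val_natAdd, zero_add]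
      rw [Fin.sum_univ_eq_sum_range (fun i => if (j : ℕ) < k.part i then 1 else 0),
        Finset.card_filter]
    have hlow : ∀ y : ℕ, ((Finset.range d).filter fun i => y < k.part i) =
        Finset.range ((Finset.range d).filter fun i => y < k.part i).card := by
      intro y
      apply lower_eq_range
      intro a b hab hb
      rw [Finset.mem_filter, Finset.mem_range] at hb ⊢
      have := k.antitone' hab
      omega
    have hlt : ∀ x y : ℕ, x < ((Finset.range d).filter fun i => y < k.part i).card ↔ y < k.part x := by
      intro x y
      rw [← Finset.mem_range, ← hlow, Finset.mem_filter, Finset.mem_range]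
      constructor
      · exact fun h => h.2
      · intro h1
        refine ⟨?_, h1⟩
        by_contra h2
        rw [part_eq_zero k (by omega)] at h1
        omega
    constructor
    · rintro (⟨i, -⟩ | ⟨j, hj, a, ha, hx⟩)
      · exact i.elim0
      · simp only at hj hx
        rw [hmy, hlt] at ha
        simp only
        rw [hj, hx, zero_add]
        exact ha
    · intro hy
      right
      simp only at hy
      have hyM : y < M := by
        have := k.antitone' (Nat.zero_le x)
        omega
      exact ⟨⟨y, hyM⟩, rfl, x, by rw [hmy, hlt]; exact hy, (zero_add _).symm⟩
  obtain ⟨p, h1, h2⟩ := hP.kill h hfh (k := k) rfl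
  have h3 := (Ld_aeval (parXY (q := q) h.ht0 h.ht 0 M) p hl).2
  rw [h2, map_smul, h0, smul_zero, MvPolynomial.coeff_zero, Eig_eq h.ht0, hbox, mul_one] at h3
  exact h1 h3.symm

lemma exists_fold [CharZero F] {N : ℕ} : ∀ (a : Fin N → ℕ) (f : Sym F), ∃ f0 : Sym F,
    ∀ (w c : ℕ → F), (∀ k, c k * w k = 1) → ∀ g,
      ip w f0 g = ip w f ((∏ i, Kel c (a i)) * g) := by
  induction N with
  | zero =>
    intro a f
    exact ⟨f, fun w c _ g => by simp⟩
  | succ N ih =>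
    intro a f
    obtain ⟨f0, h0⟩ := ih (fun i => a i.succ) (Sop (fun _ => 1) (a 0) f)
    refine ⟨f0, ?_⟩
    intro w c hc g
    rw [h0 w c hc, Fin.prod_univ_succ, ← ip_Kel_mul (c := c) hc, mul_assoc]

lemma lex_le_first {L : ℕ} (hL : 0 < L) {m m' : Fin L →₀ ℕ}
    (h : (MonomialOrder.lex (σ := Fin L)).toSyn m ≤ (MonomialOrder.lex (σ := Fin L)).toSyn m') :
    m ⟨0, hL⟩ ≤ m' ⟨0, hL⟩ := by
  by_contra hcon
  apply not_lt_of_ge h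
  rw [MonomialOrder.lex_lt_iff]
  refine Finsupp.Lex.lt_iff.mpr ⟨⟨0, hL⟩, ?_, not_le.mp hcon⟩
  intro j hj
  exact absurd (Fin.lt_def.mp hj) (Nat.not_lt_zero _)

lemma Mac.phi_ne [CharZero F] (h : Gen q t) (hP : Mac q t P) (lam : Partition) (N : ℕ) :
    phi (thXY q t N (lam.part N)) (P lam) ≠ 0 := by
  classical
  intro hphi
  set M := lam.part N with hM
  obtain ⟨f0, hf0⟩ := exists_fold (fun i : Fin N => lam.part i) (P lam)
  have hsumN : ∑ i : Fin N, lam.part i = lam.psum N := by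
    rw [Fin.sum_univ_eq_sum_range (fun i => lam.part i)]; rfl
  have hw1 : ∀ g, ip (w1 F) f0 g =
      ip (w1 F) (P lam) ((∏ i : Fin N, Kel (fun _ => (1 : F)) (lam.part i)) * g) :=
    hf0 (w1 F) (fun _ => 1) (by simp)
  have hle := psum_le_size lam N
  set d := lam.size - lam.psum N with hd
  -- homogeneity
  have hhom : Hom f0 d := by
    apply hom_of_ip (w := w1 F) (by simp)
    intro b g hg hb
    rw [hw1]
    have h1 : Hom (∏ i : Fin N, Kel (fun _ => (1 : F)) (lam.part i)) (lam.psum N) := by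
      rw [← hsumN]
      exact MvPolynomial.IsWeightedHomogeneous.prod _ _ _ fun i _ => Kel_hom _ _
    exact ip_hom_ne (hP.hom lam) (h1.mul hg) (by omega)
  -- non-vanishing
  have hne : f0 ≠ 0 := by
    intro h0
    have hanti : Antitone (fun i : Fin lam.size => lam.part (N + i)) := by
      intro i j hij
      apply lam.antitone'
      have := Fin.le_def.mp hij
      omega
    set τ := pofFin (fun i : Fin lam.size => lam.part (N + i)) hanti with hτ
    have h1 := hw1 (hprod F τ)
    rw [h0, map_zero, LinearMap.zero_apply, hprod_eq τ (n := lam.size)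
      (fun j hj => pofFin_zero _ _ hj)] at h1
    have h2 : (∏ i : Fin N, Kel (fun _ => (1 : F)) (lam.part i)) *
        ∏ i : Fin lam.size, Kel (fun _ => (1 : F)) (τ.part i) = hprod F lam := by
      rw [hprod_eq lam (n := N + lam.size) (fun j hj => part_eq_zero lam (by omega)),
        Fin.prod_univ_add]
      congr 1
      apply Finset.prod_congr rfl
      intro i _
      exact congrArg _ (pofFin_apply _ _ i)
    rw [h2, hP.one] at h1
    exact zero_ne_one h1
  -- dominance
  have hdom : ∀ ρ : Partition, ip (w1 F) f0 (hprod F ρ) ≠ 0 → ρ.part 0 ≤ M := by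
    intro ρ hρ
    set n := ρ.size + 1 with hn
    rw [hw1, hprod_eq ρ (n := n) (fun j hj => part_eq_zero ρ (by omega))] at hρ
    obtain ⟨k, h1, h2, h3, h4⟩ := exists_sort' (F := F) (n := N + n)
      (Fin.addCases (fun i : Fin N => lam.part i) (fun i : Fin n => ρ.part i))
    rw [Fin.prod_univ_add] at h2
    simp only [Fin.addCases_left, Fin.addCases_right] at h2
    rw [h2] at hρ
    have hk : Partition.Dominates lam k := by
      by_contra hk
      exact hρ (hP.tri lam k hk)
    have h5 := hk.2 (N + 1)
    have h6 : lam.psum (N + 1) = lam.psum N + M := Finset.sum_range_succ _ _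
    set T : Finset (Fin (N + n)) := insert (Fin.natAdd N (0 : Fin n))
      ((Finset.univ : Finset (Fin N)).map (Fin.castAddEmb n)) with hT
    have hnot : Fin.natAdd N (0 : Fin n) ∉ (Finset.univ : Finset (Fin N)).map (Fin.castAddEmb n) := by
      rw [Finset.mem_map]
      rintro ⟨i, -, hi⟩
      have h7 := congrArg Fin.val hi
      have := i.2
      simp at h7
      omega
    have hTc : T.card = N + 1 := by
      rw [hT, Finset.card_insert_of_notMem hnot, Finset.card_map, Finset.card_univ, Fintype.card_fin]
    have h7 := h4 T
    rw [hTc, hT, Finset.sum_insert hnot, Finset.sum_map] at h7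
    simp only [Fin.addCases_right, Fin.coe_castAddEmb, Fin.addCases_left] at h7
    rw [hsumN] at h7
    have h8 : ((0 : Fin n) : ℕ) = 0 := rfl
    rw [h8] at h7
    omega
  -- vanishing in the dual variables
  have hphi0 : phi (thXY q t 0 M) f0 = 0 := by
    ext m
    rw [MvPolynomial.coeff_zero, coeff_phi (w := wqt q t) (thXY q t 0 M) (fun _ _ => -1)]
    · rw [hf0 (wqt q t) (fun k => (wqt q t k)⁻¹) (fun k => inv_mul_cancel₀ (h.hw k))]
      have h1 := coeff_phi (w := wqt q t) (thXY q t N M)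
        (Fin.addCases (fun _ k => (wqt q t k)⁻¹) (fun _ _ => -1)) (by
          intro i k
          refine Fin.addCases (fun i => ?_) (fun i => ?_) i
          · simp only [thXY, Fin.addCases_left]
            exact inv_mul_cancel₀ (h.hw k)
          · simp only [thXY, Fin.addCases_right]
            ring)
        (Finsupp.equivFunOnFinite.symm
          (Fin.addCases (fun i : Fin N => lam.part i) (fun i : Fin M => m (Fin.natAdd 0 i)))) (P lam)
      rw [hphi, MvPolynomial.coeff_zero, Fin.prod_univ_add] at h1
      simp only [Fin.addCases_left, Fin.addCases_right, Finsupp.equivFunOnFinite_symm_apply_apply] at h1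
      rw [Fin.prod_univ_add, Fin.prod_univ_zero, one_mul]
      exact h1.symm
    · intro i k
      refine Fin.addCases (fun i => i.elim0) (fun i => ?_) i
      simp only [thXY, Fin.addCases_right]
      ring
  -- a constituent
  have hex : ∃ k ∈ parts d, ip (wqt q t) (P k) f0 ≠ 0 := by
    by_contra hcon
    push Not at hcon
    apply hne
    rw [hP.expand h hhom]
    apply Finset.sum_eq_zero
    intro k hk
    rw [hcon k hk, mul_zero, zero_smul]
  obtain ⟨k, hk, hkne⟩ := hex
  rw [mem_parts] at hk
  have hkM : k.part 0 ≤ M := by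
    obtain ⟨ρ, hρ, hev, hc, -⟩ := hP.elim_aux hhom hne
    have h1 := hdom ρ hc
    have h2 := hP.coef_le hhom hkne
    rw [← hev] at h2
    rcases Nat.eq_zero_or_pos d with hd0 | hd0
    · rw [part_eq_zero k (by omega)]
      exact Nat.zero_le _
    · refine le_trans ?_ h1
      exact lex_le_first (L := d + 0) hd0 h2
  exact hP.phi_col_ne h hkM (hP.ker_coef h hhom hphi0 hk hkne)

/-- containment -/
lemma Mac.contain [CharZero F] (h : Gen q t) (hP : Mac q t P) {lam mu : Partition}
    (hn : ¬ mu ≤ lam) {g : Sym F} {b : ℕ} (hg : Hom g b) :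
    ip (wqt q t) (P lam) (P mu * g) = 0 := by
  by_contra hne
  have hn2 : ∃ N, lam.part N < mu.part N := by
    by_contra hcon
    push Not at hcon
    exact hn hcon
  obtain ⟨N, hN⟩ := hn2
  have hhom : Hom (P mu * g) (mu.size + b) := (hP.hom mu).mul hg
  have hs : lam.size = mu.size + b := by
    by_contra hs
    exact hne (ip_hom_ne (hP.hom lam) hhom hs)
  apply hP.phi_ne h lam N
  apply hP.ker_coef h hhom _ hs hne
  rw [map_mul, hP.phi_eq_zero h hN, zero_mul]

end

section
/-! ### evaluations -/

lemma ip_one (w : ℕ → F) (f : Sym F) : ip w f 1 = MvPolynomial.constantCoeff f := by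
  rw [ip_comm, show (1 : Sym F) = MvPolynomial.monomial 0 1 from rfl, ip_monomial_left]
  simp [zw, MvPolynomial.constantCoeff_eq]

lemma const_hom {f : Sym F} {d : ℕ} (hf : Hom f d) (hd : d ≠ 0) :
    MvPolynomial.constantCoeff f = 0 := by
  by_contra h
  rw [MvPolynomial.constantCoeff_eq] at h
  have := hf h
  rw [map_zero] at this
  exact hd this.symm

lemma eval_psi (v : ℕ → F) (f : Sym F) :
    MvPolynomial.eval v f =
      Polynomial.eval 1 ((psi v f).map (MvPolynomial.constantCoeff : Sym F →+* F)) := by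
  induction f using MvPolynomial.induction_on with
  | C a => simp [psi_C]
  | add p r hp hr => rw [map_add, map_add, Polynomial.map_add, Polynomial.eval_add, hp, hr]
  | mul_X p n hp =>
    rw [map_mul, map_mul, Polynomial.map_mul, Polynomial.eval_mul, hp, psi_X]
    simp

lemma eval_eq [CharZero F] (v : ℕ → F) {f : Sym F} {d : ℕ} (hf : Hom f d) :
    MvPolynomial.eval v f = MvPolynomial.constantCoeff (Sop v d f) := by
  rw [eval_psi, Polynomial.eval_eq_sum_range' (n := (psi v f).natDegree + d + 1)
    (lt_of_le_of_lt Polynomial.natDegree_map_le (by omega)), Finset.sum_eq_single d]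
  · rw [one_pow, mul_one, Polynomial.coeff_map, Sop_apply]
  · intro r _ hr
    rw [one_pow, mul_one, Polynomial.coeff_map, ← Sop_apply]
    rcases lt_or_gt_of_ne hr with h | h
    · have h1 : Hom (Sop v r f) (d - r) := Sop_hom (by rwa [Nat.sub_add_cancel h.le])
      exact const_hom h1 (by omega)
    · rw [Sop_eq_zero hf h, map_zero]
  · intro h
    exact absurd (Finset.mem_range.mpr (by omega)) h

lemma eval_ip [CharZero F] {w c v : ℕ → F} (h : ∀ k, c k * w k = v k) {f : Sym F} {d : ℕ}
    (hf : Hom f d) : MvPolynomial.eval v f = ip w f (Kel c d) := by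
  rw [eval_eq v hf, ← ip_one w, ← ip_Kel_mul h, mul_one]

lemma eval_scale [CharZero F] (a : F) (v : ℕ → F) {f : Sym F} {d : ℕ} (hf : Hom f d) :
    MvPolynomial.eval (fun k => a ^ (k + 1) * v k) f = a ^ d * MvPolynomial.eval v f := by
  rw [eval_eq _ hf, eval_eq _ hf, Sop_scale, MvPolynomial.smul_eq_C_mul, map_mul,
    MvPolynomial.constantCoeff_C]

/-! ### the kernel is multiplicative -/

lemma ode_unique [CharZero F] {V A B : PowerSeries (Sym F)}
    (h0 : PowerSeries.coeff 0 A = PowerSeries.coeff 0 B)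
    (hA : PowerSeries.derivative (Sym F) A = V * A) (hB : PowerSeries.derivative (Sym F) B = V * B) :
    A = B := by
  ext1 n
  induction n using Nat.strong_induction_on with
  | _ n ih =>
  rcases n with _ | n
  · exact h0
  have h1 := congrArg (PowerSeries.coeff n) hA
  have h2 := congrArg (PowerSeries.coeff n) hB
  rw [PowerSeries.coeff_derivative, PowerSeries.coeff_mul] at h1 h2
  have h3 : ∑ p ∈ Finset.HasAntidiagonal.antidiagonal n, PowerSeries.coeff p.1 V * PowerSeries.coeff p.2 A =
      ∑ p ∈ Finset.HasAntidiagonal.antidiagonal n, PowerSeries.coeff p.1 V * PowerSeries.coeff p.2 B := by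
    apply Finset.sum_congr rfl
    intro p hp
    rw [Finset.HasAntidiagonal.mem_antidiagonal] at hp
    rw [ih p.2 (by omega)]
  rw [h3, ← h2] at h1
  refine mul_right_cancel₀ ?_ h1
  have : ((n : Sym F) + 1) = ((n + 1 : ℕ) : Sym F) := by push_cast; rfl
  rw [this]
  exact_mod_cast Nat.succ_ne_zero n

/-- generating series -/
def Kser (c : ℕ → F) : PowerSeries (Sym F) := PowerSeries.mk (Kel c)

/-- logarithmic derivative of the generating series -/
def Vser (c : ℕ → F) : PowerSeries (Sym F) := PowerSeries.mk fun k => c k • MvPolynomial.X k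

lemma Kser_ode [CharZero F] (c : ℕ → F) :
    PowerSeries.derivative (Sym F) (Kser c) = Vser c * Kser c := by
  ext1 n
  rw [PowerSeries.coeff_derivative, PowerSeries.coeff_mul,
    Finset.Nat.sum_antidiagonal_eq_sum_range_succ_mk]
  simp only [Kser, Vser, PowerSeries.coeff_mk]
  have := Kel_rec c (n + 1)
  rw [MvPolynomial.smul_eq_C_mul] at this
  simp only [Nat.add_sub_cancel] at this
  rw [show Kel c (n + 1) * ((n : Sym F) + 1) = MvPolynomial.C (((n + 1 : ℕ) : F)) * Kel c (n + 1) by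
    rw [mul_comm]; simp, this]
  apply Finset.sum_congr rfl
  intro k _
  rw [smul_mul_assoc]

lemma Kel_add [CharZero F] (c c' : ℕ → F) (r : ℕ) :
    Kel (fun k => c k + c' k) r = ∑ p ∈ Finset.HasAntidiagonal.antidiagonal r, Kel c p.1 * Kel c' p.2 := by
  have h : Kser (fun k => c k + c' k) = Kser c * Kser c' := by
    apply ode_unique (V := Vser fun k => c k + c' k)
    · simp [Kser, Kel_zero]
    · exact Kser_ode _
    · rw [Derivation.leibniz, Kser_ode, Kser_ode]
      have : (Vser fun k => c k + c' k) = Vser c + Vser c' := by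
        ext1 n
        simp [Vser, add_smul]
      rw [this]
      simp only [smul_eq_mul]
      ring
  have h2 := congrArg (PowerSeries.coeff r) h
  rw [PowerSeries.coeff_mul] at h2
  simpa [Kser] using h2

/-! ### skew functions -/

variable {q t : F} {P : Partition → Sym F}

lemma skew_eq [CharZero F] (hP : Mac q t P) (lam mu : Partition) :
    skewQ q t P lam mu = ∑ k ∈ parts (lam.size - mu.size),
      (bnorm q t P lam * ip (wqt q t) (P lam) (P mu * P k) * bnorm q t P k) • P k := by
  rw [skewQ, finsum_eq_sum_of_support_subset (s := parts (lam.size - mu.size))]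
  · apply Finset.sum_congr rfl
    intro k _
    rw [innerQT_eq, macQ, macQ, map_smul, LinearMap.smul_apply, smul_smul]
    rfl
  · intro k hk
    rw [Finset.mem_coe, mem_parts]
    by_contra hne
    apply hk
    show innerQT q t (macQ q t P lam) (P mu * P k) • macQ q t P k = 0
    rw [innerQT_eq, macQ, map_smul, LinearMap.smul_apply,
      ip_hom_ne (hP.hom lam) ((hP.hom mu).mul (hP.hom k)) (by omega), smul_zero, zero_smul]

lemma skew_hom [CharZero F] (hP : Mac q t P) (lam mu : Partition) :
    Hom (skewQ q t P lam mu) (lam.size - mu.size) := by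
  rw [skew_eq hP]
  apply MvPolynomial.IsWeightedHomogeneous.sum
  intro k hk
  have := hP.hom k
  rw [mem_parts.mp hk] at this
  exact this.smul _

lemma skew_ip [CharZero F] (h : Gen q t) (hP : Mac q t P) (lam mu : Partition) {g : Sym F}
    (hg : Hom g (lam.size - mu.size)) :
    ip (wqt q t) (skewQ q t P lam mu) g =
      bnorm q t P lam * ip (wqt q t) (P lam) (P mu * g) := by
  conv_rhs => rw [hP.expand h hg]
  rw [skew_eq hP, map_sum, LinearMap.sum_apply, Finset.mul_sum, map_sum, Finset.mul_sum]
  apply Finset.sum_congr rfl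
  intro k _
  rw [mul_smul_comm, map_smul, map_smul, LinearMap.smul_apply, smul_eq_mul, smul_eq_mul,
    bnorm, bnorm, innerQT_eq, innerQT_eq]
  change _ * ip (wqt q t) _ _ * (ip (wqt q t) (P k) (P k))⁻¹ * _ = _
  ring

lemma size_mono {mu lam : Partition} (h : mu ≤ lam) : mu.size ≤ lam.size := by
  have h1 := size_eq_psum mu (n := mu.size + lam.size) fun j hj => part_eq_zero mu (by omega)
  have h2 := size_eq_psum lam (n := mu.size + lam.size) fun j hj => part_eq_zero lam (by omega)
  have h3 : mu.psum (mu.size + lam.size) ≤ lam.psum (mu.size + lam.size) :=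
    Finset.sum_le_sum fun j _ => h j
  omega

lemma le_trans_part {a b c : Partition} (h1 : a ≤ b) (h2 : b ≤ c) : a ≤ c :=
  fun j => (h1 j).trans (h2 j)

theorem main_sum [CharZero F] (h : Gen q t) (hP : Mac q t P) (lam nu : Partition) :
    (∑ᶠ (mu : Partition) (_ : nu ≤ mu ∧ mu ≤ lam),
      (-t) ^ (lam.size - mu.size) * vsM q t P lam mu *
        plethAB t 1 (q * t) (skewQ q t P mu nu)) = hsM q t P lam nu := by
  classical
  set w := wqt q t with hw
  set b := bnorm q t P with hb
  set c1 : ℕ → F := fun k =>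
    (t ^ (k + 1) * ((q ^ (k + 1) - 1 ^ (k + 1)) / (1 - t ^ (k + 1)))) / w k with hc1
  set c2 : ℕ → F := fun k =>
    ((1 ^ (k + 1) - (q * t) ^ (k + 1)) / (1 - t ^ (k + 1))) / w k with hc2
  set T : Partition → F := fun mu =>
    (b lam * ip w (P lam) (P mu * Kel c1 (lam.size - mu.size))) *
      (b mu * ip w (P mu) (P nu * Kel c2 (mu.size - nu.size))) with hT
  have hterm : ∀ mu : Partition, mu ≤ lam → (-t) ^ (lam.size - mu.size) * vsM q t P lam mu *
        plethAB t 1 (q * t) (skewQ q t P mu nu) = T mu := by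
    intro mu hmu
    have hs := size_mono hmu
    rw [hT]
    simp only
    rw [← skew_ip h hP lam mu (Kel_hom _ _), ← skew_ip h hP mu nu (Kel_hom _ _),
      ← eval_ip (v := fun k => t ^ (k + 1) * ((q ^ (k + 1) - 1 ^ (k + 1)) / (1 - t ^ (k + 1))))
        (fun k => div_mul_cancel₀ _ (h.hw k)) (skew_hom hP lam mu),
      ← eval_ip (v := fun k => (1 ^ (k + 1) - (q * t) ^ (k + 1)) / (1 - t ^ (k + 1)))
        (fun k => div_mul_cancel₀ _ (h.hw k)) (skew_hom hP mu nu),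
      eval_scale t _ (skew_hom hP lam mu), vsM, plethAB, plethAB, ← mul_assoc]
    congr 2
    rw [← Nat.cast_sub hs, zpow_natCast, ← mul_pow]
    congr 1
    ring
  have hrhs : hsM q t P lam nu =
      b lam * ip w (P lam) (P nu * Kel (fun k => c2 k + c1 k) (lam.size - nu.size)) := by
    rw [hsM, ← skew_ip h hP lam nu (Kel_hom _ _)]
    apply eval_ip _ (skew_hom hP lam nu)
    intro k
    have h1 := h.hq k
    have h2 := h.ht k
    simp only [hc1, hc2, hw, wqt, one_pow, mul_pow]
    generalize q ^ (k + 1) = x at *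
    generalize t ^ (k + 1) = y at *
    field_simp
    ring
  by_cases hnl : nu ≤ lam
  swap
  · rw [hrhs, hP.contain h hnl (Kel_hom _ _), mul_zero]
    apply finsum_eq_zero_of_forall_eq_zero
    intro mu
    rw [finsum_eq_if, if_neg fun hmu => hnl (le_trans_part hmu.1 hmu.2)]
  have hs := size_mono hnl
  set n := lam.size - nu.size with hn
  set S : Finset Partition := (Finset.range (n + 1)).biUnion fun j => parts (nu.size + j) with hS
  have hlhs : (∑ᶠ (mu : Partition) (_ : nu ≤ mu ∧ mu ≤ lam),
      (-t) ^ (lam.size - mu.size) * vsM q t P lam mu *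
        plethAB t 1 (q * t) (skewQ q t P mu nu)) = ∑ mu ∈ S, T mu := by
    rw [finsum_eq_sum_of_support_subset (s := S)]
    · apply Finset.sum_congr rfl
      intro mu _
      rw [finsum_eq_if]
      split_ifs with hmu
      · exact hterm mu hmu.2
      · rw [hT]
        simp only
        by_cases h1 : mu ≤ lam
        · have h2 : ¬ nu ≤ mu := fun h2 => hmu ⟨h2, h1⟩
          rw [hP.contain h h2 (Kel_hom _ _), mul_zero, mul_zero]
        · rw [hP.contain h h1 (Kel_hom _ _), mul_zero, zero_mul]
    · intro mu hmu
      rw [Function.mem_support, finsum_eq_if] at hmu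
      split_ifs at hmu with h1
      · have h2 := size_mono h1.1
        have h3 := size_mono h1.2
        rw [Finset.mem_coe, hS, Finset.mem_biUnion]
        exact ⟨mu.size - nu.size, Finset.mem_range.mpr (by omega), mem_parts.mpr (by omega)⟩
      · exact absurd rfl hmu
  rw [hlhs, hrhs, Kel_add, hS, Finset.sum_biUnion,
    Finset.Nat.sum_antidiagonal_eq_sum_range_succ_mk, Finset.mul_sum, map_sum, Finset.mul_sum]
  · apply Finset.sum_congr rfl
    intro j hj
    have hj2 : j ≤ n := Nat.lt_succ_iff.mp (Finset.mem_range.mp hj)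
    have hh : Hom (P nu * Kel c2 j) (nu.size + j) := (hP.hom nu).mul (Kel_hom _ _)
    have hexp := hP.expand h hh
    simp only
    rw [← mul_assoc, hexp, Finset.sum_mul, map_sum, Finset.mul_sum]
    apply Finset.sum_congr rfl
    intro mu hmu
    have hmu2 := mem_parts.mp hmu
    have e1 : mu.size - nu.size = j := by omega
    have e2 : lam.size - mu.size = n - j := by omega
    have e3 : b mu = (ip w (P mu) (P mu))⁻¹ := by
      rw [hb, bnorm, innerQT_eq]
      rfl
    rw [smul_mul_assoc, map_smul, smul_eq_mul, hT]
    simp only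
    rw [e1, e2, e3]
    ring
  · intro i _ j _ hij
    rw [Function.onFun, Finset.disjoint_left]
    intro mu h1 h2
    rw [mem_parts] at h1 h2
    omega

end

section
lemma t1_transcendental : Transcendental ℚ t1 := by
  have := RatFunc.transcendental_X (K := ℚ)
  convert this
  · exact Subsingleton.elim _ _
  · rfl

lemma q2_transcendental : Transcendental F1 q2 := RatFunc.transcendental_X

lemma gen_F2 : Gen q2 t2 := by
  classical
  have ht1 : Transcendental ℚ (t1⁻¹ : F1) := by
    intro h
    exact t1_transcendental (IsAlgebraic.inv_iff.mp h)
  have ht0 : t2 ≠ 0 := by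
    rw [t2]
    intro h
    rw [map_eq_zero] at h
    exact RatFunc.X_ne_zero h
  have hinj : ∀ S T : Finset (ℕ × ℕ),
    ∑ p ∈ S, t2⁻¹ ^ p.1 * q2 ^ p.2 = ∑ p ∈ T, t2⁻¹ ^ p.1 * q2 ^ p.2 → S = T := by
    intro S T h
    set A : Finset (ℕ × ℕ) → Polynomial F1 := fun S =>
      ∑ p ∈ S, Polynomial.C ((t1⁻¹ : F1) ^ p.1) * Polynomial.X ^ p.2 with hA
    have h1 : ∀ S, Polynomial.aeval q2 (A S) = ∑ p ∈ S, t2⁻¹ ^ p.1 * q2 ^ p.2 := by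
      intro S
      rw [hA]
      simp only [map_sum, map_mul, map_pow, Polynomial.aeval_X, Polynomial.aeval_C, map_inv₀]
      rfl
    have h2 : A S = A T := by
      rw [← sub_eq_zero]
      by_contra hne
      exact q2_transcendental ⟨A S - A T, hne, by rw [map_sub, h1, h1, h, sub_self]⟩
    set B : Finset (ℕ × ℕ) → ℕ → Polynomial ℚ := fun S y =>
      ∑ p ∈ S, if p.2 = y then Polynomial.X ^ p.1 else 0 with hB
    have h3 : ∀ S y, Polynomial.aeval (t1⁻¹ : F1) (B S y) = (A S).coeff y := by
      intro S y
      rw [hA, hB]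
      simp only [map_sum, Polynomial.finsetSum_coeff, Polynomial.coeff_C_mul, Polynomial.coeff_X_pow]
      apply Finset.sum_congr rfl
      intro p _
      by_cases hp : p.2 = y
      · simp [hp]
      · simp [hp, Ne.symm hp]
    have h4 : ∀ y, B S y = B T y := by
      intro y
      rw [← sub_eq_zero]
      by_contra hne
      exact ht1 ⟨B S y - B T y, hne, by rw [map_sub, h3, h3, h2, sub_self]⟩
    have h5 : ∀ S x y, (B S y).coeff x = if (x, y) ∈ S then 1 else 0 := by
      intro S x y
      rw [hB]
      simp only [Polynomial.finsetSum_coeff]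
      rw [← Finset.sum_ite_eq' S (x, y) (fun _ => (1 : ℚ))]
      apply Finset.sum_congr rfl
      rintro ⟨a, b⟩ _
      by_cases hb : b = y
      · by_cases ha : a = x
        · simp [hb, ha]
        · simp [hb, ha, Ne.symm ha, Polynomial.coeff_X_pow]
      · simp [hb]
    ext ⟨x, y⟩
    have h6 := congrArg (fun p => Polynomial.coeff p x) (h4 y)
    simp only [h5] at h6
    by_cases hS : (x, y) ∈ S <;> by_cases hT : (x, y) ∈ T
    · exact ⟨fun _ => hT, fun _ => hS⟩
    · rw [if_pos hS, if_neg hT] at h6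
      exact absurd h6 one_ne_zero
    · rw [if_neg hS, if_pos hT] at h6
      exact absurd h6.symm one_ne_zero
    · exact ⟨fun h => absurd h hS, fun h => absurd h hT⟩
  refine ⟨ht0, ?_, ?_, hinj⟩
  · intro k hk
    have := hinj {(0, 0)} {(0, k + 1)} (by simpa using sub_eq_zero.mp hk)
    simp at this
  · intro k hk
    have h1 : t2 ^ (k + 1) = 1 := (sub_eq_zero.mp hk).symm
    have := hinj {(0, 0)} {(k + 1, 0)} (by simp [h1])
    simp at this

instance charZero_F2 : CharZero F2 := inferInstance

end

/-- `q`-analogue of Konvalinka--Lauve's Lemma 5: for all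
partitions `λ, ν`,
`∑_μ (-t)^{|λ|-|μ|} vs_{λ/μ}(q,t) Q_{μ/ν}((1-qt)/(1-t)) = hs_{λ/ν}(q,t)`,
the sum over partitions `μ` with `ν ⊆ μ ⊆ λ`. -/
theorem vs_sk_sum_q_analogue
    (P : Partition → Sym F2) (hP : IsMacdonald q2 t2 P) (lam nu : Partition) :
    (∑ᶠ (mu : Partition) (_ : nu ≤ mu ∧ mu ≤ lam),
        (-t2) ^ (lam.size - mu.size) * vsM q2 t2 P lam mu *
          plethAB t2 1 (q2 * t2) (skewQ q2 t2 P mu nu)) =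
      hsM q2 t2 P lam nu := by
  exact main_sum gen_F2 (IsMacdonald.mac gen_F2 hP) lam nu

end SkewPieriFormalization
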